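/- Let Γ be a metric graph of genus g and let D be a very special divisor on Γ (Clifford inequality for metric graphs). Then deg(D) ≥ 2·rk(D). -/

import Mathlib

noncomputable section

/-- The star with `n` rays of radius `r` in the complex plane:
`{ z ∈ ℂ : z = t·e^{2πik/n}, t ∈ [0,r], k ∈ ℤ }`. -/
def starSet (n : ℕ) (r : ℝ) : Set ℂ :=
  {z | ∃ t ∈ Set.Icc (0 : ℝ) r, ∃ k : ℤ,
    z = (t : ℂ) * Complex.exp (2 * (Real.pi : ℂ) * Complex.I * (k : ℂ) / (n : ℂ))}

/-- `P` has a neighbourhood isometric to a star with `n` rays of some radius `r > 0`,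
with `P` corresponding to `0`. -/
def HasStarNbhd (Γ : Type*) [MetricSpace Γ] (P : Γ) (n : ℕ) : Prop :=
  ∃ r > (0 : ℝ), ∃ U ∈ nhds P, ∃ φ : Γ → ℂ,
    φ P = 0 ∧ φ '' U = starSet n r ∧
    ∀ x ∈ U, ∀ y ∈ U, dist (φ x) (φ y) = dist x y

/-- A metric graph: a compact connected metric space in which every point has a
neighbourhood isometric to a star with `n ≥ 1` rays. -/
def IsMetricGraph (Γ : Type*) [MetricSpace Γ] : Prop :=
  CompactSpace Γ ∧ ConnectedSpace Γ ∧ ∀ P : Γ, ∃ n : ℕ, 1 ≤ n ∧ HasStarNbhd Γ P n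

/-- The valence of a point: the number of rays of a star neighbourhood. -/
noncomputable def valence (Γ : Type*) [MetricSpace Γ] (P : Γ) : ℕ :=
  sInf {n : ℕ | 1 ≤ n ∧ HasStarNbhd Γ P n}

/-- A vertex is a point of valence different from `2`. -/
def IsVertex (Γ : Type*) [MetricSpace Γ] (P : Γ) : Prop := valence Γ P ≠ 2

/-- The genus of a metric graph: `#edges - #vertices + 1`, the edges being the connected
components of the complement of the vertex set. -/
noncomputable def graphGenus (Γ : Type*) [MetricSpace Γ] : ℤ :=
  (Nat.card (ConnectedComponents {P : Γ // ¬ IsVertex Γ P}) : ℤ)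
    - (Nat.card {P : Γ // IsVertex Γ P} : ℤ) + 1

/-- A divisor on `Γ` : a finitely supported formal `ℤ`-linear combination of points. -/
abbrev Divisor (Γ : Type*) : Type _ := Γ →₀ ℤ

/-- The degree of a divisor. -/
def divDeg {Γ : Type*} (D : Divisor Γ) : ℤ := D.sum fun _ n => n

/-- A divisor is effective if all its coefficients are nonnegative. -/
def Effective {Γ : Type*} (D : Divisor Γ) : Prop := ∀ P : Γ, 0 ≤ D P

/-- An arc based at `P` : an isometric parametrization of a segment emanating from `P`. -/
def IsArcAt {Γ : Type*} [MetricSpace Γ] (P : Γ) (τ : ℝ → Γ) : Prop :=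
  τ 0 = P ∧ ∃ a > (0 : ℝ), ∀ s ∈ Set.Icc (0 : ℝ) a, ∀ t ∈ Set.Icc (0 : ℝ) a,
    dist (τ s) (τ t) = |s - t|

/-- Two arcs are equivalent (define the same tangent direction) when they agree near `0`. -/
def ArcEquiv {Γ : Type*} (τ τ' : ℝ → Γ) : Prop :=
  ∃ ε > (0 : ℝ), ∀ t ∈ Set.Icc (0 : ℝ) ε, τ t = τ' t

/-- `f` has (one-sided) slope `s` along the arc `τ`. -/
def HasSlopeAlong {Γ : Type*} (f : Γ → ℝ) (τ : ℝ → Γ) (s : ℤ) : Prop :=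
  ∃ ε > (0 : ℝ), ∀ t ∈ Set.Icc (0 : ℝ) ε, f (τ t) = f (τ 0) + (s : ℝ) * t

/-- A rational function on a metric graph: continuous and piecewise affine with
integer slopes, i.e. having an integer slope along every arc. -/
def IsRational (Γ : Type*) [MetricSpace Γ] (f : Γ → ℝ) : Prop :=
  Continuous f ∧ ∀ (P : Γ) (τ : ℝ → Γ), IsArcAt P τ → ∃ s : ℤ, HasSlopeAlong f τ s

/-- `div f` has coefficient `m` at `P`: the sum of the slopes of `f` in all tangent
directions emanating from `P` equals `m`. -/
def HasOrderAt (Γ : Type*) [MetricSpace Γ] (f : Γ → ℝ) (P : Γ) (m : ℤ) : Prop :=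
  ∃ (n : ℕ) (τ : Fin n → ℝ → Γ) (s : Fin n → ℤ),
    (∀ i, IsArcAt P (τ i)) ∧
    Pairwise (fun i j => ¬ ArcEquiv (τ i) (τ j)) ∧
    (∀ σ : ℝ → Γ, IsArcAt P σ → ∃ i, ArcEquiv σ (τ i)) ∧
    (∀ i, HasSlopeAlong f (τ i) (s i)) ∧
    m = ∑ i, s i

/-- Linear equivalence of divisors: `D₂ - D₁ = div f` for some rational function `f`. -/
def LinEquiv (Γ : Type*) [MetricSpace Γ] (D₁ D₂ : Divisor Γ) : Prop :=
  ∃ f : Γ → ℝ, IsRational Γ f ∧ ∀ P : Γ, HasOrderAt Γ f P (D₂ P - D₁ P)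

/-- `D` is linearly equivalent to an effective divisor. -/
def EquivEffective (Γ : Type*) [MetricSpace Γ] (D : Divisor Γ) : Prop :=
  ∃ D' : Divisor Γ, Effective D' ∧ LinEquiv Γ D D'

/-- For every effective divisor `E` of degree `r`, `D - E` is linearly equivalent to an
effective divisor. -/
def RankGE (Γ : Type*) [MetricSpace Γ] (D : Divisor Γ) (r : ℕ) : Prop :=
  ∀ E : Divisor Γ, Effective E → divDeg E = (r : ℤ) → EquivEffective Γ (D - E)

/-- The rank of a divisor: `-1` if `D` is not equivalent to an effective divisor, and
otherwise the largest `r ≥ 0` such that `D - E` is equivalent to an effective divisor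
for every effective `E` of degree `r`. -/
noncomputable def divRank (Γ : Type*) [MetricSpace Γ] (D : Divisor Γ) : ℤ :=
  sSup (insert (-1) {n : ℤ | ∃ r : ℕ, n = (r : ℤ) ∧ RankGE Γ D r})

/-- The arc `τ` immediately leaves the set `X`. -/
def ArcLeaves {Γ : Type*} (X : Set Γ) (τ : ℝ → Γ) : Prop :=
  ∃ ε > (0 : ℝ), ∀ t ∈ Set.Ioc (0 : ℝ) ε, τ t ∉ X

/-- `P` is a non-saturated boundary point of `X` with respect to `D` : the number of
tangent directions at `P` leaving `X` is strictly greater than `D P`. -/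
def NonSaturated (Γ : Type*) [MetricSpace Γ] (D : Divisor Γ) (X : Set Γ) (P : Γ) : Prop :=
  P ∈ frontier X ∧ ∃ (n : ℕ) (τ : Fin n → ℝ → Γ),
    (∀ i, IsArcAt P (τ i)) ∧ (∀ i, ArcLeaves X (τ i)) ∧
    Pairwise (fun i j => ¬ ArcEquiv (τ i) (τ j)) ∧ D P < (n : ℤ)

/-- `D` is `P₀`-reduced. -/
def IsReducedDivisor (Γ : Type*) [MetricSpace Γ] (D : Divisor Γ) (P₀ : Γ) : Prop :=
  (∀ P : Γ, P ≠ P₀ → 0 ≤ D P) ∧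
  ∀ X : Set Γ, IsClosed X → X.Nonempty → P₀ ∉ X → ∃ P, NonSaturated Γ D X P

/-- The restriction of a divisor on `Γ` to a divisor on a subset `S` (with the induced
metric); divisors supported on `S` are identified with divisors on `S` this way. -/
noncomputable def DivRestrict {Γ : Type*} (S : Set Γ) (D : Divisor Γ) : Divisor ↥S :=
  Finsupp.comapDomain Subtype.val D Subtype.coe_injective.injOn

/-- Linear equivalence computed on the subgraph `S` of `Γ`. -/
def LinEquivOn {Γ : Type*} [MetricSpace Γ] (S : Set Γ) (D₁ D₂ : Divisor Γ) : Prop :=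
  LinEquiv ↥S (DivRestrict S D₁) (DivRestrict S D₂)

/-- The rank computed on the subgraph `S` of `Γ`. -/
noncomputable def divRankOn {Γ : Type*} [MetricSpace Γ] (S : Set Γ) (D : Divisor Γ) : ℤ :=
  divRank ↥S (DivRestrict S D)

/-- A free divisor: effective, of rank at least one, and removing any point decreases
the rank. -/
def IsFreeDivisor (Γ : Type*) [MetricSpace Γ] (D : Divisor Γ) : Prop :=
  Effective D ∧ 1 ≤ divRank Γ D ∧
  ∀ P : Γ, divRank Γ (D - Finsupp.single P 1) < divRank Γ D

/-- The canonical divisor `K_Γ = Σ_P (val(P) - 2)·P`. -/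
def IsCanonical (Γ : Type*) [MetricSpace Γ] (K : Divisor Γ) : Prop :=
  ∀ P : Γ, K P = (valence Γ P : ℤ) - 2

/-- A very special divisor: effective with `rk(D) > 0` and `rk(K_Γ - D) > 0`. -/
def VerySpecial (Γ : Type*) [MetricSpace Γ] (D : Divisor Γ) : Prop :=
  Effective D ∧ 0 < divRank Γ D ∧
  ∃ K : Divisor Γ, IsCanonical Γ K ∧ 0 < divRank Γ (K - D)

/-- `φ` is an `L`-periodic locally isometric parametrization of the circle `S ⊆ Γ`
of circumference `L`. -/
def CircleParam {Γ : Type*} [MetricSpace Γ] (S : Set Γ) (L : ℝ) (φ : ℝ → Γ) : Prop :=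
  0 < L ∧ (∀ t : ℝ, φ (t + L) = φ t) ∧ Set.range φ = S ∧
  ∀ s t : ℝ, |s - t| ≤ L / 2 → dist (φ s) (φ t) = |s - t|

/-- `S` is a metric circle inside `Γ`. -/
def IsCircleSet {Γ : Type*} [MetricSpace Γ] (S : Set Γ) : Prop :=
  ∃ (L : ℝ) (φ : ℝ → Γ), CircleParam S L φ

end

open Set

section Directions

variable {Γ : Type}

theorem ArcEquiv.symm {τ τ' : ℝ → Γ} (h : ArcEquiv τ τ') : ArcEquiv τ' τ := by
  obtain ⟨ε, hε, h⟩ := h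
  exact ⟨ε, hε, fun t ht => (h t ht).symm⟩

theorem ArcEquiv.trans {τ τ' τ'' : ℝ → Γ} (h : ArcEquiv τ τ') (h' : ArcEquiv τ' τ'') :
    ArcEquiv τ τ'' := by
  obtain ⟨ε, hε, h⟩ := h
  obtain ⟨ε', hε', h'⟩ := h'
  refine ⟨min ε ε', lt_min hε hε', fun t ht => ?_⟩
  rw [h t ⟨ht.1, ht.2.trans (min_le_left _ _)⟩, h' t ⟨ht.1, ht.2.trans (min_le_right _ _)⟩]

theorem HasSlopeAlong.congr {f : Γ → ℝ} {τ τ' : ℝ → Γ} {s : ℤ} (h : HasSlopeAlong f τ s)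
    (e : ArcEquiv τ τ') : HasSlopeAlong f τ' s := by
  obtain ⟨ε, hε, h⟩ := h
  obtain ⟨ε', hε', h'⟩ := e
  refine ⟨min ε ε', lt_min hε hε', fun t ht => ?_⟩
  rw [← h' t ⟨ht.1, ht.2.trans (min_le_right _ _)⟩, ← h' 0 ⟨le_rfl, hε'.le⟩,
    h t ⟨ht.1, ht.2.trans (min_le_left _ _)⟩]

theorem HasSlopeAlong.unique {f : Γ → ℝ} {τ : ℝ → Γ} {s s' : ℤ} (h : HasSlopeAlong f τ s)
    (h' : HasSlopeAlong f τ s') : s = s' := by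
  obtain ⟨ε, hε, h⟩ := h
  obtain ⟨ε', hε', h'⟩ := h'
  have hm : 0 < min ε ε' := lt_min hε hε'
  have h1 := h _ ⟨hm.le, min_le_left _ _⟩
  have h2 := h' _ ⟨hm.le, min_le_right _ _⟩
  rw [h1] at h2
  have h3 := mul_right_cancel₀ hm.ne' (add_left_cancel h2)
  exact_mod_cast h3

theorem HasSlopeAlong.add {f g : Γ → ℝ} {τ : ℝ → Γ} {s s' : ℤ} (h : HasSlopeAlong f τ s)
    (h' : HasSlopeAlong g τ s') : HasSlopeAlong (f + g) τ (s + s') := by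
  obtain ⟨ε, hε, h⟩ := h
  obtain ⟨ε', hε', h'⟩ := h'
  refine ⟨min ε ε', lt_min hε hε', fun t ht => ?_⟩
  rw [Pi.add_apply, Pi.add_apply, h t ⟨ht.1, ht.2.trans (min_le_left _ _)⟩,
    h' t ⟨ht.1, ht.2.trans (min_le_right _ _)⟩]
  push_cast
  ring

theorem HasSlopeAlong.neg {f : Γ → ℝ} {τ : ℝ → Γ} {s : ℤ} (h : HasSlopeAlong f τ s) :
    HasSlopeAlong (-f) τ (-s) := by
  obtain ⟨ε, hε, h⟩ := h
  refine ⟨ε, hε, fun t ht => ?_⟩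
  rw [Pi.neg_apply, Pi.neg_apply, h t ht]
  push_cast
  ring

theorem HasSlopeAlong.zero (τ : ℝ → Γ) : HasSlopeAlong (0 : Γ → ℝ) τ 0 :=
  ⟨1, one_pos, fun t _ => by simp⟩

variable [MetricSpace Γ]

/-- A complete irredundant system of tangent directions at `P`. -/
structure IsDirections (P : Γ) {ι : Type} (τ : ι → ℝ → Γ) : Prop where
  arc : ∀ i, IsArcAt P (τ i)
  distinct : ∀ i j, ArcEquiv (τ i) (τ j) → i = j
  complete : ∀ σ : ℝ → Γ, IsArcAt P σ → ∃ i, ArcEquiv σ (τ i)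

theorem IsDirections.exists_equiv {P : Γ} {ι κ : Type} {τ : ι → ℝ → Γ} {τ' : κ → ℝ → Γ}
    (h : IsDirections P τ) (h' : IsDirections P τ') :
    ∃ e : ι ≃ κ, ∀ i, ArcEquiv (τ i) (τ' (e i)) := by
  choose e he using fun i => h'.complete (τ i) (h.arc i)
  have hb : Function.Bijective e := by
    refine ⟨fun i j hij => h.distinct i j ?_, fun k => ?_⟩
    · have := he j
      rw [← hij] at this
      exact (he i).trans this.symm
    · obtain ⟨i, hi⟩ := h.complete (τ' k) (h'.arc k)
      exact ⟨i, (h'.distinct _ _ (hi.trans (he i))).symm⟩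
  exact ⟨Equiv.ofBijective e hb, he⟩

theorem IsDirections.hasOrderAt {P : Γ} {ι : Type} [Fintype ι] {τ : ι → ℝ → Γ}
    (h : IsDirections P τ) {f : Γ → ℝ} {s : ι → ℤ} (hs : ∀ i, HasSlopeAlong f (τ i) (s i)) :
    HasOrderAt Γ f P (∑ i, s i) := by
  let e := Fintype.equivFin ι
  refine ⟨Fintype.card ι, fun k => τ (e.symm k), fun k => s (e.symm k), fun k => h.arc _,
    fun i j hij hE => hij (e.symm.injective (h.distinct _ _ hE)), fun σ hσ => ?_,
    fun k => hs _, (e.symm.sum_comp s).symm⟩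
  obtain ⟨i, hi⟩ := h.complete σ hσ
  exact ⟨e i, by simpa using hi⟩

theorem HasOrderAt.eq_sum {P : Γ} {ι : Type} [Fintype ι] {τ : ι → ℝ → Γ}
    {f : Γ → ℝ} {s : ι → ℤ} {m : ℤ} (hm : HasOrderAt Γ f P m)
    (h : IsDirections P τ) (hs : ∀ i, HasSlopeAlong f (τ i) (s i)) : m = ∑ i, s i := by
  obtain ⟨n, τ', s', h1, h2, h3, h4, rfl⟩ := hm
  have h' : IsDirections P τ' := ⟨h1, fun i j hij => by_contra fun hne => h2 hne hij, h3⟩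
  obtain ⟨e, he⟩ := h'.exists_equiv h
  rw [← e.sum_comp s]
  exact Finset.sum_congr rfl fun i _ => ((h4 i).congr (he i)).unique (hs _)

theorem HasOrderAt.add {P : Γ} {f g : Γ → ℝ} {m m' : ℤ} (h : HasOrderAt Γ f P m)
    (h' : HasOrderAt Γ g P m') : HasOrderAt Γ (f + g) P (m + m') := by
  have hg := h'
  obtain ⟨n, τ, s, h1, h2, h3, h4, rfl⟩ := h
  obtain ⟨n', τ', s', h1', h2', h3', h4', rfl⟩ := h'
  have hd : IsDirections P τ := ⟨h1, fun i j hij => by_contra fun hne => h2 hne hij, h3⟩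
  choose k hk using fun i => h3' (τ i) (h1 i)
  have hs : ∀ i, HasSlopeAlong g (τ i) (s' (k i)) := fun i => (h4' (k i)).congr (hk i).symm
  rw [hg.eq_sum hd hs, ← Finset.sum_add_distrib]
  exact hd.hasOrderAt fun i => (h4 i).add (hs i)

theorem HasOrderAt.neg {P : Γ} {f : Γ → ℝ} {m : ℤ} (h : HasOrderAt Γ f P m) :
    HasOrderAt Γ (-f) P (-m) := by
  obtain ⟨n, τ, s, h1, h2, h3, h4, rfl⟩ := h
  exact ⟨n, τ, fun i => -s i, h1, h2, h3, fun i => (h4 i).neg, by simp⟩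

theorem IsRational.add {f g : Γ → ℝ} (hf : IsRational Γ f) (hg : IsRational Γ g) :
    IsRational Γ (f + g) := by
  refine ⟨hf.1.add hg.1, fun P τ hτ => ?_⟩
  obtain ⟨s, hs⟩ := hf.2 P τ hτ
  obtain ⟨t, ht⟩ := hg.2 P τ hτ
  exact ⟨_, hs.add ht⟩

theorem IsRational.neg {f : Γ → ℝ} (hf : IsRational Γ f) : IsRational Γ (-f) := by
  refine ⟨hf.1.neg, fun P τ hτ => ?_⟩
  obtain ⟨s, hs⟩ := hf.2 P τ hτ
  exact ⟨_, hs.neg⟩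

end Directions

theorem IsPreconnected.subset_of_finite_isClosed {X ι : Type*} [TopologicalSpace X] [Finite ι]
    {S : Set X} (hS : IsPreconnected S) {C : ι → Set X} (hC : ∀ i, IsClosed (C i))
    (hcov : S ⊆ ⋃ i, C i) (hdisj : ∀ i j, ∀ x ∈ S, x ∈ C i → x ∈ C j → i = j)
    {i : ι} {x : X} (hx : x ∈ S) (hxi : x ∈ C i) : S ⊆ C i := by
  intro y hy
  by_contra hyi
  obtain ⟨j, hj⟩ := mem_iUnion.1 (hcov hy)
  have hji : j ≠ i := by rintro rfl; exact hyi hj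
  have hcl : IsClosed (⋃ k : {k // k ≠ i}, C k) := isClosed_iUnion_of_finite fun k => hC k
  obtain ⟨z, hz, hz1, hz2⟩ := isPreconnected_closed_iff.1 hS (C i) _ (hC i) hcl
    (fun z hz => by
      obtain ⟨k, hk⟩ := mem_iUnion.1 (hcov hz)
      by_cases hki : k = i
      · exact Or.inl (hki ▸ hk)
      · exact Or.inr (mem_iUnion.2 ⟨⟨k, hki⟩, hk⟩))
    ⟨x, hx, hxi⟩ ⟨y, hy, mem_iUnion.2 ⟨⟨j, hji⟩, hj⟩⟩
  obtain ⟨⟨k, hki⟩, hk⟩ := mem_iUnion.1 hz2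
  exact hki (hdisj k i z hz hk hz1)

theorem exists_pos_forall_lt {ι : Type*} [Finite ι] {a : ι → ℝ} (ha : ∀ i, 0 < a i) :
    ∃ c > 0, ∀ i, c < a i := by
  cases isEmpty_or_nonempty ι
  · exact ⟨1, one_pos, isEmptyElim⟩
  · obtain ⟨i, hi⟩ := Finite.exists_min a
    exact ⟨a i / 2, half_pos (ha i), fun j => (half_lt_self (ha i)).trans_le (hi j)⟩

section Star

variable {Γ : Type} [MetricSpace Γ]

/-- A parametrization which is isometric on an interval is continuous there. -/
theorem continuousOn_of_dist_eq {γ : ℝ → Γ} {S : Set ℝ}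
    (h : ∀ s ∈ S, ∀ t ∈ S, dist (γ s) (γ t) = |s - t|) : ContinuousOn γ S := by
  refine LipschitzOnWith.continuousOn (K := 1) (LipschitzOnWith.of_dist_le_mul fun s hs t ht => ?_)
  simp [h s hs t ht, Real.dist_eq]

/-- Segments emanating from `P` which are disjoint apart from `P` and fill up a
neighbourhood of `P`. -/
structure IsStar (P : Γ) {ι : Type} (τ : ι → ℝ → Γ) (a : ι → ℝ) : Prop where
  pos : ∀ i, 0 < a i
  zero : ∀ i, τ i 0 = P
  isom : ∀ i, ∀ s ∈ Icc 0 (a i), ∀ t ∈ Icc 0 (a i), dist (τ i s) (τ i t) = |s - t|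
  inj : ∀ i j, ∀ s ∈ Ioo 0 (a i), ∀ t ∈ Ioo 0 (a j), τ i s = τ j t → i = j
  cover : ∃ ε > 0, ∀ x, dist x P < ε → x ≠ P → ∃ i, ∃ t ∈ Ioo 0 (a i), τ i t = x

namespace IsStar

variable {P : Γ} {ι : Type} {τ : ι → ℝ → Γ} {a : ι → ℝ} (h : IsStar P τ a)

include h

theorem dist_eq {i : ι} {t : ℝ} (ht : t ∈ Icc 0 (a i)) : dist (τ i t) P = t := by
  have := h.isom i t ht 0 ⟨le_rfl, (h.pos i).le⟩
  rwa [h.zero, sub_zero, abs_of_nonneg ht.1] at this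

theorem exists_equiv [Finite ι] {σ : ℝ → Γ} (hσ : IsArcAt P σ) : ∃ i, ArcEquiv σ (τ i) := by
  obtain ⟨h0, b, hb, hσ⟩ := hσ
  obtain ⟨ε, hε, hcov⟩ := h.cover
  obtain ⟨c₀, hc₀, hca⟩ := exists_pos_forall_lt h.pos
  obtain ⟨c, hc, hcb, hcε, hcc⟩ : ∃ c > 0, c ≤ b ∧ c < ε ∧ c ≤ c₀ :=
    ⟨min (min b (ε / 2)) c₀, lt_min (lt_min hb (half_pos hε)) hc₀,
      (min_le_left _ _).trans (min_le_left _ _),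
      ((min_le_left _ _).trans (min_le_right _ _)).trans_lt (half_lt_self hε), min_le_right _ _⟩
  have hca : ∀ i, c < a i := fun i => hcc.trans_lt (hca i)
  have hdist : ∀ t ∈ Icc 0 c, dist (σ t) P = t := fun t ht => by
    have := hσ t ⟨ht.1, ht.2.trans hcb⟩ 0 ⟨le_rfl, hb.le⟩
    rwa [h0, sub_zero, abs_of_nonneg ht.1] at this
  have key : ∀ t ∈ Ioc 0 c, ∃ i, τ i t = σ t := by
    intro t ht
    have hd := hdist t ⟨ht.1.le, ht.2⟩
    obtain ⟨i, t', ht', he⟩ := hcov (σ t) (by rw [hd]; exact ht.2.trans_lt hcε)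
      (by rw [← dist_pos, hd]; exact ht.1)
    have : t' = t := by rw [← h.dist_eq ⟨ht'.1.le, ht'.2.le⟩, he, hd]
    subst this
    exact ⟨i, he⟩
  let C : ι → Set ℝ := fun i => Icc 0 c ∩ (fun t => dist (τ i t) (σ t)) ⁻¹' {0}
  have hC : ∀ i, IsClosed (C i) := fun i => by
    have h1 : ContinuousOn (τ i) (Icc 0 c) :=
      (continuousOn_of_dist_eq (h.isom i)).mono (Icc_subset_Icc_right (hca i).le)
    have h2 : ContinuousOn σ (Icc 0 c) :=
      (continuousOn_of_dist_eq hσ).mono (Icc_subset_Icc_right hcb)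
    have h3 : ContinuousOn (fun t => dist (τ i t) (σ t)) (Icc 0 c) :=
      continuous_dist.comp_continuousOn (h1.prodMk h2)
    exact h3.preimage_isClosed_of_isClosed isClosed_Icc isClosed_singleton
  obtain ⟨i, he⟩ := key c ⟨hc, le_rfl⟩
  have hsub := (isPreconnected_Ioc (a := 0) (b := c)).subset_of_finite_isClosed hC
    (fun t ht => by
      obtain ⟨j, he⟩ := key t ht
      exact mem_iUnion.2 ⟨j, ⟨ht.1.le, ht.2⟩, by simp [he]⟩)
    (fun j k t ht hj hk => h.inj j k t ⟨ht.1, ht.2.trans_lt (hca j)⟩ t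
      ⟨ht.1, ht.2.trans_lt (hca k)⟩
      ((dist_eq_zero.1 hj.2).trans (dist_eq_zero.1 hk.2).symm))
    (show c ∈ Ioc 0 c from ⟨hc, le_rfl⟩)
    (show c ∈ C i from ⟨⟨hc.le, le_rfl⟩, by simp [he]⟩)
  refine ⟨i, c, hc, fun t ht => ?_⟩
  rcases ht.1.eq_or_lt with rfl | h1
  · rw [h0, h.zero]
  · exact (dist_eq_zero.1 (hsub ⟨h1, ht.2⟩).2).symm

theorem isDirections [Finite ι] : IsDirections P τ where
  arc i := ⟨h.zero i, a i, h.pos i, h.isom i⟩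
  distinct i j := by
    rintro ⟨ε, hε, he⟩
    have hm : 0 < min ε (min (a i) (a j)) := lt_min hε (lt_min (h.pos i) (h.pos j))
    obtain ⟨t, ht, ht'⟩ := exists_between hm
    have h1 := lt_min_iff.1 ht'
    have h2 := lt_min_iff.1 h1.2
    exact h.inj i j t ⟨ht, h2.1⟩ t ⟨ht, h2.2⟩ (he t ⟨ht.le, h1.1.le⟩)
  complete _ hσ := h.exists_equiv hσ

theorem continuousAt [Finite ι] {f : Γ → ℝ} {s : ι → ℤ}
    (hs : ∀ i, HasSlopeAlong f (τ i) (s i)) : ContinuousAt f P := by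
  have := Fintype.ofFinite ι
  obtain ⟨ε, hε, hcov⟩ := h.cover
  choose δ hδ hf using hs
  obtain ⟨c, hc, hcδ⟩ := exists_pos_forall_lt hδ
  have hbound : ∀ x, dist x P < min ε c → dist (f x) (f P) ≤ (∑ i, |(s i : ℝ)|) * dist x P := by
    intro x hx
    obtain ⟨hx1, hx2⟩ := lt_min_iff.1 hx
    by_cases hxP : x = P
    · simp [hxP]
    obtain ⟨i, t, ht, rfl⟩ := hcov x hx1 hxP
    rw [h.dist_eq ⟨ht.1.le, ht.2.le⟩] at hx2 ⊢
    rw [hf i t ⟨ht.1.le, (hx2.trans (hcδ i)).le⟩, h.zero, Real.dist_eq, add_sub_cancel_left,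
      abs_mul, abs_of_pos ht.1]
    exact mul_le_mul_of_nonneg_right
      (Finset.single_le_sum (f := fun i => |(s i : ℝ)|) (fun _ _ => abs_nonneg _)
        (Finset.mem_univ i)) ht.1.le
  rw [ContinuousAt, tendsto_iff_dist_tendsto_zero]
  have h0 : Filter.Tendsto (fun x => (∑ i, |(s i : ℝ)|) * dist x P) (nhds P) (nhds 0) := by
    have : Continuous fun x => (∑ i, |(s i : ℝ)|) * dist x P := by fun_prop
    simpa using this.tendsto P
  refine squeeze_zero' (Filter.Eventually.of_forall fun _ => dist_nonneg) ?_ h0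
  filter_upwards [Metric.ball_mem_nhds P (lt_min hε hc)] with x hx using hbound x hx

theorem exists_hasSlopeAlong [Finite ι] {f : Γ → ℝ} {s : ι → ℤ}
    (hs : ∀ i, HasSlopeAlong f (τ i) (s i)) {σ : ℝ → Γ} (hσ : IsArcAt P σ) :
    ∃ m, HasSlopeAlong f σ m := by
  obtain ⟨i, hi⟩ := h.exists_equiv hσ
  exact ⟨s i, (hs i).congr hi.symm⟩

end IsStar
end Star

section Valence

variable {Γ : Type} [MetricSpace Γ]

/-- The `k`-th direction of the star with `n` rays. -/
noncomputable def rayDir (n k : ℕ) : ℂ := Complex.exp (2 * Real.pi * Complex.I / n) ^ k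

theorem norm_rayDir (n k : ℕ) : ‖rayDir n k‖ = 1 := by
  have : (2 * (Real.pi : ℂ) * Complex.I / n) = ((2 * Real.pi / n : ℝ) : ℂ) * Complex.I := by
    push_cast
    ring
  rw [rayDir, norm_pow, this, Complex.norm_exp_ofReal_mul_I, one_pow]

theorem rayDir_inj {n j k : ℕ} (hj : j < n) (hk : k < n) (h : rayDir n j = rayDir n k) : j = k :=
  (Complex.isPrimitiveRoot_exp n (by omega)).pow_inj hj hk h

theorem mem_starSet_iff {n : ℕ} (hn : 1 ≤ n) {r : ℝ} {z : ℂ} :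
    z ∈ starSet n r ↔ ∃ t ∈ Icc 0 r, ∃ k : Fin n, z = t * rayDir n k := by
  have hn0 : (n : ℂ) ≠ 0 := Nat.cast_ne_zero.2 (by omega)
  have hz : (n : ℤ) ≠ 0 := by omega
  constructor
  · rintro ⟨t, ht, k, rfl⟩
    have hpos := Int.emod_nonneg k hz
    have hlt := Int.emod_lt_of_pos k (show (0 : ℤ) < n by omega)
    refine ⟨t, ht, ⟨(k % n).toNat, by omega⟩, ?_⟩
    congr 1
    have h1 := Complex.isPrimitiveRoot_exp n (by omega)
    have h2 : Complex.exp (2 * Real.pi * Complex.I * k / n)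
        = Complex.exp (2 * Real.pi * Complex.I / n) ^ k := by
      rw [← Complex.exp_int_mul]
      congr 1
      ring
    rw [h2, rayDir, ← zpow_natCast]
    simp only [Int.toNat_of_nonneg hpos]
    conv_lhs => rw [← Int.emod_add_mul_ediv k n]
    rw [zpow_add₀ (Complex.exp_ne_zero _), zpow_mul, zpow_natCast _ n, h1.pow_eq_one, one_zpow,
      mul_one]
  · rintro ⟨t, ht, k, rfl⟩
    refine ⟨t, ht, (k : ℕ), ?_⟩
    rw [rayDir, ← Complex.exp_nat_mul]
    congr 2
    push_cast
    ring

theorem HasStarNbhd.exists_isStar {P : Γ} {n : ℕ} (hn : 1 ≤ n) (h : HasStarNbhd Γ P n) :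
    ∃ (τ : Fin n → ℝ → Γ) (r : ℝ), IsStar P τ fun _ => r := by
  obtain ⟨r, hr, U, hU, φ, h0, himg, hiso⟩ := h
  have hmem : ∀ (k : Fin n) (t : ℝ), t ∈ Icc 0 r → ∃ x ∈ U, φ x = t * rayDir n k := fun k t ht => by
    have : (t : ℂ) * rayDir n k ∈ φ '' U := himg ▸ (mem_starSet_iff hn).2 ⟨t, ht, k, rfl⟩
    exact this
  have : Nonempty Γ := ⟨P⟩
  choose! g hgU hg using hmem
  have hPU := mem_of_mem_nhds hU
  have hinj : ∀ x ∈ U, ∀ y ∈ U, φ x = φ y → x = y := fun x hx y hy e => by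
    rw [← dist_eq_zero, ← hiso x hx y hy, e, dist_self]
  have hn' : ∀ (k : Fin n) (t : ℝ), ‖(t : ℂ) * rayDir n k‖ = |t| := fun k t => by
    rw [norm_mul, norm_rayDir, mul_one, Complex.norm_real, Real.norm_eq_abs]
  refine ⟨g, r, fun _ => hr, fun k => ?_, fun k s hs t ht => ?_, fun j k s hs t ht he => ?_, ?_⟩
  · have hz : (0 : ℝ) ∈ Icc 0 r := ⟨le_rfl, hr.le⟩
    exact hinj _ (hgU k 0 hz) _ hPU (by rw [hg k 0 hz, h0]; simp)
  · rw [← hiso _ (hgU k s hs) _ (hgU k t ht), hg k s hs, hg k t ht, dist_eq_norm, ← sub_mul,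
      ← Complex.ofReal_sub, hn']
  · have he' : (s : ℂ) * rayDir n j = t * rayDir n k := by
      rw [← hg j s ⟨hs.1.le, hs.2.le⟩, ← hg k t ⟨ht.1.le, ht.2.le⟩, he]
    have hst : s = t := by
      have := congrArg norm he'
      rwa [hn', hn', abs_of_pos hs.1, abs_of_pos ht.1] at this
    subst hst
    have hs0 : (s : ℂ) ≠ 0 := Complex.ofReal_ne_zero.2 hs.1.ne'
    exact Fin.ext (rayDir_inj j.2 k.2 (mul_left_cancel₀ hs0 he'))
  · obtain ⟨ε, hε, hball⟩ := Metric.mem_nhds_iff.1 hU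
    refine ⟨min ε r, lt_min hε hr, fun x hx hxP => ?_⟩
    have hxU : x ∈ U := hball (hx.trans_le (min_le_left _ _))
    have hφx : φ x ∈ starSet n r := himg ▸ mem_image_of_mem φ hxU
    obtain ⟨t, ht, k, he⟩ := (mem_starSet_iff hn).1 hφx
    have htd : dist x P = t := by
      rw [← hiso x hxU P hPU, h0, dist_zero_right, he, hn', abs_of_nonneg ht.1]
    refine ⟨k, t, ⟨?_, ?_⟩, ?_⟩
    · rw [← htd]; exact dist_pos.2 hxP
    · rw [← htd]; exact hx.trans_le (min_le_right _ _)
    · exact hinj _ (hgU k t ht) _ hxU (by rw [hg k t ht, he])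

theorem IsMetricGraph.exists_isStar (hΓ : IsMetricGraph Γ) (P : Γ) :
    ∃ (τ : Fin (valence Γ P) → ℝ → Γ) (r : ℝ), IsStar P τ fun _ => r := by
  obtain ⟨h1, h2⟩ := Nat.sInf_mem (s := {n : ℕ | 1 ≤ n ∧ HasStarNbhd Γ P n}) (hΓ.2.2 P)
  exact h2.exists_isStar h1

theorem IsMetricGraph.valence_eq_card (hΓ : IsMetricGraph Γ) {P : Γ} {ι : Type} [Fintype ι]
    {τ : ι → ℝ → Γ} (h : IsDirections P τ) : valence Γ P = Fintype.card ι := by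
  obtain ⟨τ', r, h'⟩ := hΓ.exists_isStar P
  obtain ⟨e, -⟩ := h'.isDirections.exists_equiv h
  simpa using Fintype.card_congr e

end Valence

section Model

/-- A decomposition of `Γ` into a finite set of points `V` and finitely many open segments,
the edges, each of which is parametrized isometrically. -/
structure GraphModel (Γ : Type) [MetricSpace Γ] where
  /-- the distinguished points -/
  V : Finset Γ
  /-- the index type of the edges -/
  E : Type
  fintypeE : Fintype E
  /-- the length of an edge -/
  len : E → ℝ
  /-- the parametrization of an edge -/
  param : E → ℝ → Γ
  len_pos : ∀ e, 0 < len e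
  isom : ∀ e, ∀ s ∈ Icc 0 (len e), ∀ t ∈ Icc 0 (len e), dist (param e s) (param e t) = |s - t|
  left_mem : ∀ e, param e 0 ∈ V
  right_mem : ∀ e, param e (len e) ∈ V
  interior : ∀ e, ∀ t ∈ Ioo 0 (len e), param e t ∉ V
  inj : ∀ e e', ∀ s ∈ Ioo 0 (len e), ∀ t ∈ Ioo 0 (len e'), param e s = param e' t → e = e'
  cover : ∀ x, x ∉ V → ∃ e, ∃ t ∈ Ioo 0 (len e), param e t = x

variable {Γ : Type} [MetricSpace Γ]

theorem IsStar.isOpen_image {P : Γ} {ι : Type} [Finite ι] {τ : ι → ℝ → Γ} {ρ : ℝ}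
    (h : IsStar P τ fun _ => ρ)
    (hcov : ∀ x, dist x P < ρ → x ≠ P → ∃ i, ∃ t ∈ Ioo 0 ρ, τ i t = x) (k : ι) {a b : ℝ}
    (ha : 0 ≤ a) (hb : b ≤ ρ) : IsOpen (τ k '' Ioo a b) := by
  have hclosed : ∀ j c d, 0 ≤ c → d ≤ ρ → IsClosed (τ j '' Icc c d) := fun j c d hc hd =>
    (isCompact_Icc.image_of_continuousOn
      ((continuousOn_of_dist_eq (h.isom j)).mono (Icc_subset_Icc hc hd))).isClosed
  have heq : τ k '' Ioo a b = Metric.ball P ρ \ (({P} ∪ ⋃ j : {j // j ≠ k}, τ j '' Icc 0 ρ) ∪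
      (τ k '' Icc 0 a ∪ τ k '' Icc b ρ)) := by
    ext x
    constructor
    · rintro ⟨t, ht, rfl⟩
      have ht0 : 0 < t := ha.trans_lt ht.1
      have htρ : t < ρ := ht.2.trans_le hb
      have hd : dist (τ k t) P = t := h.dist_eq (i := k) ⟨ht0.le, htρ.le⟩
      refine ⟨by rw [Metric.mem_ball, hd]; exact htρ, ?_⟩
      have aux : ∀ j s, s ∈ Icc 0 ρ → τ j s = τ k t → s = t := fun j s hs e => by
        rw [← h.dist_eq (i := j) hs, e, hd]
      rintro ((hP | hj) | (⟨s, hs, he⟩ | ⟨s, hs, he⟩))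
      · rw [mem_singleton_iff.1 hP, dist_self] at hd
        exact ht0.ne hd
      · obtain ⟨⟨j, hjk⟩, s, hs, he⟩ := mem_iUnion.1 hj
        obtain rfl := aux j s hs he
        exact hjk (h.inj j k s ⟨ht0, htρ⟩ s ⟨ht0, htρ⟩ he)
      · obtain rfl := aux k s ⟨hs.1, hs.2.trans (ht.1.le.trans htρ.le)⟩ he
        exact absurd hs.2 (not_le.2 ht.1)
      · obtain rfl := aux k s ⟨ht0.le.trans (ht.2.le.trans hs.1), hs.2⟩ he
        exact absurd hs.1 (not_le.2 ht.2)
    · rintro ⟨hx, hx'⟩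
      simp only [mem_union, not_or] at hx'
      obtain ⟨⟨h1, h2⟩, h3, h4⟩ := hx'
      obtain ⟨i, t, ht, rfl⟩ := hcov x hx h1
      have hik : i = k := by
        by_contra hne
        exact h2 (mem_iUnion.2 ⟨⟨i, hne⟩, t, ⟨ht.1.le, ht.2.le⟩, rfl⟩)
      subst hik
      refine ⟨t, ⟨?_, ?_⟩, rfl⟩
      · by_contra hta
        exact h3 ⟨t, ⟨ht.1.le, not_lt.1 hta⟩, rfl⟩
      · by_contra htb
        exact h4 ⟨t, ⟨not_lt.1 htb, ht.2.le⟩, rfl⟩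
  rw [heq]
  have hρ : 0 < ρ := h.pos k
  by_cases haρ : a ≤ ρ
  · by_cases hb0 : 0 ≤ b
    · refine Metric.isOpen_ball.sdiff ((isClosed_singleton.union
        (isClosed_iUnion_of_finite fun j => hclosed _ _ _ le_rfl le_rfl)).union
        ((hclosed _ _ _ le_rfl haρ).union (hclosed _ _ _ hb0 le_rfl)))
    · rw [← heq, Ioo_eq_empty (by linarith), image_empty]
      exact isOpen_empty
  · rw [← heq, Ioo_eq_empty (by linarith), image_empty]
    exact isOpen_empty

theorem IsMetricGraph.exists_uniform_star (hΓ : IsMetricGraph Γ) (P : Γ) :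
    ∃ (τ : Fin (valence Γ P) → ℝ → Γ) (ρ : ℝ), 0 < ρ ∧ (IsStar P τ fun _ => ρ) ∧
      ∀ x, dist x P < ρ → x ≠ P → ∃ i, ∃ t ∈ Ioo 0 ρ, τ i t = x := by
  obtain ⟨τ, r, h⟩ := hΓ.exists_isStar P
  obtain ⟨ε, hε, hcov⟩ := h.cover
  by_cases hr : 0 < r
  · have hcov' : ∀ x, dist x P < min ε r → x ≠ P → ∃ i, ∃ t ∈ Ioo 0 (min ε r), τ i t = x := by
      intro x hx hxP
      obtain ⟨i, t, ht, rfl⟩ := hcov x (hx.trans_le (min_le_left _ _)) hxP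
      rw [h.dist_eq (i := i) ⟨ht.1.le, ht.2.le⟩] at hx
      exact ⟨i, t, ⟨ht.1, hx⟩, rfl⟩
    refine ⟨τ, min ε r, lt_min hε hr, ⟨fun _ => lt_min hε hr, h.zero, fun i s hs t ht => ?_,
      fun i j s hs t ht => ?_, min ε r, lt_min hε hr, hcov'⟩, hcov'⟩
    · exact h.isom i s ⟨hs.1, hs.2.trans (min_le_right _ _)⟩ t ⟨ht.1, ht.2.trans (min_le_right _ _)⟩
    · exact h.inj i j s ⟨hs.1, hs.2.trans_le (min_le_right _ _)⟩ t
        ⟨ht.1, ht.2.trans_le (min_le_right _ _)⟩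
  · have hempty : IsEmpty (Fin (valence Γ P)) := ⟨fun i => hr (h.pos i)⟩
    refine ⟨τ, ε, hε, ⟨isEmptyElim, isEmptyElim, isEmptyElim, isEmptyElim, ε, hε, ?_⟩, ?_⟩ <;>
    · intro x hx hxP
      obtain ⟨i, -⟩ := hcov x hx hxP
      exact isEmptyElim i

theorem IsMetricGraph.exists_model (hΓ : IsMetricGraph Γ) (S : Finset Γ) :
    ∃ M : GraphModel Γ, S ⊆ M.V := by
  classical
  choose τ ρ hρ hst hcov using hΓ.exists_uniform_star
  have := hΓ.1
  obtain ⟨T, -, hT⟩ := isCompact_univ.elim_nhds_subcover (fun P : Γ => Metric.ball P (ρ P))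
    fun P _ => Metric.ball_mem_nhds P (hρ P)
  have hd : ∀ c k t, t ∈ Icc 0 (ρ c) → dist (τ c k t) c = t := fun c k t ht =>
    (hst c).dist_eq (i := k) ht
  let V : Finset Γ := S ∪ (T ∪ T.biUnion fun c => Finset.univ.image fun k => τ c k (ρ c))
  have hSV : S ⊆ V := Finset.subset_union_left
  have hTV : ∀ c ∈ T, c ∈ V := fun c hc =>
    Finset.mem_union_right _ (Finset.mem_union_left _ hc)
  have hTV' : ∀ c ∈ T, ∀ k, τ c k (ρ c) ∈ V := fun c hc k =>
    Finset.mem_union_right _ (Finset.mem_union_right _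
      (Finset.mem_biUnion.2 ⟨c, hc, Finset.mem_image_of_mem _ (Finset.mem_univ k)⟩))
  clear_value V
  let IsEdge : Set Γ → (c : Γ) → Fin (valence Γ c) → ℝ → ℝ → Prop := fun A c k a b =>
    c ∈ T ∧ 0 ≤ a ∧ a < b ∧ b ≤ ρ c ∧ τ c k a ∈ V ∧ τ c k b ∈ V ∧
      (∀ u ∈ Ioo a b, τ c k u ∉ V) ∧ A = τ c k '' Ioo a b
  let 𝓔 : Set (Set Γ) := {A | ∃ c k a b, IsEdge A c k a b}
  have hfin : 𝓔.Finite := by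
    let W : Γ → Set ℝ := fun c => (fun x => dist x c) '' V
    have hW : ∀ c, (W c).Finite := fun c => V.finite_toSet.image _
    have : (⋃ c ∈ T, ⋃ k : Fin (valence Γ c), ⋃ a ∈ W c, ⋃ b ∈ W c,
        {τ c k '' Ioo a b}).Finite := by
      refine T.finite_toSet.biUnion fun c _ => finite_iUnion fun k => (hW c).biUnion fun a _ =>
        (hW c).biUnion fun b _ => finite_singleton _
    refine this.subset ?_
    rintro A ⟨c, k, a, b, hc, ha, hab, hb, hVa, hVb, -, rfl⟩
    simp only [mem_iUnion, mem_singleton_iff, exists_prop]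
    exact ⟨c, hc, k, a, ⟨_, hVa, hd c k a ⟨ha, hab.le.trans hb⟩⟩, b,
      ⟨_, hVb, hd c k b ⟨ha.trans hab.le, hb⟩⟩, rfl⟩
  have hsub : ∀ A ∈ 𝓔, ∀ A' ∈ 𝓔, (A' ∩ A).Nonempty → A' ⊆ A := by
    rintro A ⟨c, k, a, b, hc, ha, hab, hb, hVa, hVb, -, rfl⟩
      A' ⟨c', k', a', b', hc', ha', hab', hb', -, -, hV', rfl⟩ hne
    have hpre : IsPreconnected (τ c' k' '' Ioo a' b') :=
      isPreconnected_Ioo.image _ ((continuousOn_of_dist_eq ((hst c').isom k')).mono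
        fun u hu => ⟨ha'.trans hu.1.le, hu.2.le.trans hb'⟩)
    refine hpre.subset_of_closure_inter_subset ((hst c).isOpen_image (hcov c) k ha hb) hne ?_
    have hcl : closure (τ c k '' Ioo a b) ⊆ τ c k '' Icc a b :=
      closure_minimal (image_mono Ioo_subset_Icc_self)
        (isCompact_Icc.image_of_continuousOn ((continuousOn_of_dist_eq ((hst c).isom k)).mono
          (Icc_subset_Icc ha hb))).isClosed
    rintro x ⟨hx, u', hu', rfl⟩
    obtain ⟨u, hu, he⟩ := hcl hx
    have hxV := hV' u' hu'
    rw [← he] at hxV ⊢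
    refine ⟨u, ⟨lt_of_le_of_ne hu.1 ?_, lt_of_le_of_ne hu.2 ?_⟩, rfl⟩
    · rintro rfl; exact hxV hVa
    · rintro rfl; exact hxV hVb
  choose c k a b hE using fun A : 𝓔 => A.2
  refine ⟨{
    V := V
    E := 𝓔
    fintypeE := hfin.fintype
    len := fun A => b A - a A
    param := fun A t => τ (c A) (k A) (a A + t)
    len_pos := fun A => sub_pos.2 (hE A).2.2.1
    isom := fun A s hs t ht => ?_
    left_mem := fun A => by simpa using (hE A).2.2.2.2.1
    right_mem := fun A => by simpa using (hE A).2.2.2.2.2.1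
    interior := fun A t ht => (hE A).2.2.2.2.2.2.1 _ ⟨by linarith [ht.1], by linarith [ht.2]⟩
    inj := fun A A' s hs t ht he => ?_
    cover := fun x hx => ?_ }, hSV⟩
  · obtain ⟨-, h1, -, h2, -⟩ := hE A
    have := (hst (c A)).isom (k A) (a A + s) ⟨by linarith [hs.1], by linarith [hs.2]⟩
      (a A + t) ⟨by linarith [ht.1], by linarith [ht.2]⟩
    rwa [add_sub_add_left_eq_sub] at this
  · have hA : τ (c A) (k A) (a A + s) ∈ (A : Set Γ) := by
      rw [(hE A).2.2.2.2.2.2.2]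
      exact ⟨_, ⟨by linarith [hs.1], by linarith [hs.2]⟩, rfl⟩
    have hA' : τ (c A) (k A) (a A + s) ∈ (A' : Set Γ) := by
      rw [(hE A').2.2.2.2.2.2.2, he]
      exact ⟨_, ⟨by linarith [ht.1], by linarith [ht.2]⟩, rfl⟩
    exact Subtype.ext (Subset.antisymm (hsub _ A'.2 _ A.2 ⟨_, hA, hA'⟩)
      (hsub _ A.2 _ A'.2 ⟨_, hA', hA⟩))
  · obtain ⟨p, hp, hxp⟩ := mem_iUnion₂.1 (hT (mem_univ x))
    have hxne : x ≠ p := by rintro rfl; exact hx (hTV _ hp)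
    obtain ⟨j, t, ht, rfl⟩ := hcov p x hxp hxne
    have hTf : {u | u ∈ Icc 0 (ρ p) ∧ τ p j u ∈ V}.Finite := by
      refine (V.finite_toSet.image fun x => dist x p).subset ?_
      rintro u ⟨hu, huV⟩
      exact ⟨_, huV, hd p j u hu⟩
    obtain ⟨α, ⟨⟨hα, hαV⟩, hαt⟩, hαmax⟩ := exists_max_image
      ({u | u ∈ Icc 0 (ρ p) ∧ τ p j u ∈ V} ∩ Iic t) id (hTf.inter_of_left _)
      ⟨0, ⟨⟨le_rfl, (hρ p).le⟩, by rw [(hst p).zero]; exact hTV p hp⟩, ht.1.le⟩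
    obtain ⟨β, ⟨⟨hβ, hβV⟩, hβt⟩, hβmin⟩ := exists_min_image
      ({u | u ∈ Icc 0 (ρ p) ∧ τ p j u ∈ V} ∩ Ici t) id (hTf.inter_of_left _)
      ⟨ρ p, ⟨⟨(hρ p).le, le_rfl⟩, hTV' p hp j⟩, ht.2.le⟩
    have hαt' : α < t := lt_of_le_of_ne hαt (by rintro rfl; exact hx hαV)
    have hβt' : t < β := lt_of_le_of_ne hβt (by rintro rfl; exact hx hβV)
    have hmem : τ p j '' Ioo α β ∈ 𝓔 := by
      refine ⟨p, j, α, β, hp, hα.1, hαt'.trans hβt', hβ.2, hαV, hβV, fun u hu huV => ?_, rfl⟩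
      have hu' : u ∈ Icc 0 (ρ p) := ⟨hα.1.trans hu.1.le, hu.2.le.trans hβ.2⟩
      rcases le_total u t with hut | hut
      · exact absurd (hαmax u ⟨⟨hu', huV⟩, hut⟩) (not_le.2 hu.1)
      · exact absurd (hβmin u ⟨⟨hu', huV⟩, hut⟩) (not_le.2 hu.2)
    have hxA : τ p j t ∈ τ p j '' Ioo α β := ⟨t, ⟨hαt', hβt'⟩, rfl⟩
    have hEA := (hE ⟨_, hmem⟩).2.2.2.2.2.2.2
    simp only at hEA
    rw [hEA] at hxA
    obtain ⟨u, hu, he⟩ := hxA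
    refine ⟨⟨_, hmem⟩, u - a ⟨_, hmem⟩, ⟨sub_pos.2 hu.1, sub_lt_sub_right hu.2 _⟩, ?_⟩
    simpa using he

end Model

namespace GraphModel

variable {Γ : Type} [MetricSpace Γ] (M : GraphModel Γ)

instance : Fintype M.E := M.fintypeE

/-- An edge together with an orientation; `true` stands for the reversed orientation. -/
abbrev Dart : Type := M.E × Bool

variable {M}

/-- The length of the underlying edge. -/
def Dart.length (δ : M.Dart) : ℝ := M.len δ.1

/-- The edge traversed in the direction given by the orientation. -/
def Dart.arc (δ : M.Dart) (t : ℝ) : Γ := M.param δ.1 (if δ.2 then M.len δ.1 - t else t)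

/-- The opposite orientation. -/
def Dart.opp (δ : M.Dart) : M.Dart := (δ.1, !δ.2)

/-- The initial point. -/
def Dart.base (δ : M.Dart) : Γ := δ.arc 0

/-- The final point. -/
def Dart.tip (δ : M.Dart) : Γ := δ.opp.base

theorem Dart.length_pos (δ : M.Dart) : 0 < δ.length := M.len_pos _

@[simp] theorem Dart.length_opp (δ : M.Dart) : δ.opp.length = δ.length := rfl

@[simp] theorem Dart.opp_opp (δ : M.Dart) : δ.opp.opp = δ := by simp [Dart.opp]

theorem Dart.opp_arc (δ : M.Dart) (t : ℝ) : δ.opp.arc t = δ.arc (δ.length - t) := by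
  obtain ⟨e, _ | _⟩ := δ <;> simp [Dart.opp, Dart.arc, Dart.length]

@[simp] theorem Dart.base_opp (δ : M.Dart) : δ.opp.base = δ.tip := rfl

@[simp] theorem Dart.tip_opp (δ : M.Dart) : δ.opp.tip = δ.base := by simp [Dart.tip]

theorem Dart.arc_zero (δ : M.Dart) : δ.arc 0 = δ.base := rfl

theorem Dart.arc_length (δ : M.Dart) : δ.arc δ.length = δ.tip := by
  rw [← Dart.base_opp, ← Dart.arc_zero, Dart.opp_arc, sub_zero]

theorem Dart.base_mem (δ : M.Dart) : δ.base ∈ M.V := by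
  obtain ⟨e, _ | _⟩ := δ
  · simpa [Dart.base, Dart.arc] using M.left_mem e
  · simpa [Dart.base, Dart.arc] using M.right_mem e

theorem Dart.tip_mem (δ : M.Dart) : δ.tip ∈ M.V := δ.opp.base_mem

theorem Dart.isom (δ : M.Dart) : ∀ s ∈ Icc 0 δ.length, ∀ t ∈ Icc 0 δ.length,
    dist (δ.arc s) (δ.arc t) = |s - t| := by
  obtain ⟨e, _ | _⟩ := δ
  · simpa [Dart.arc, Dart.length] using M.isom e
  · intro s hs t ht
    simp only [Dart.length] at hs ht
    simp only [Dart.arc, if_true]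
    rw [M.isom e _ ⟨by linarith [hs.2], by linarith [hs.1]⟩ _
      ⟨by linarith [ht.2], by linarith [ht.1]⟩, abs_sub_comm]
    congr 1
    ring

theorem Dart.interior (δ : M.Dart) : ∀ t ∈ Ioo 0 δ.length, δ.arc t ∉ M.V := by
  obtain ⟨e, _ | _⟩ := δ
  · simpa [Dart.arc, Dart.length] using M.interior e
  · intro t ht
    simp only [Dart.length] at ht
    simp only [Dart.arc, if_true]
    exact M.interior e _ ⟨by linarith [ht.2], by linarith [ht.1]⟩

theorem Dart.eq_or_eq_of_mem (δ : M.Dart) {t : ℝ} (ht : t ∈ Icc 0 δ.length)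
    (h : δ.arc t ∈ M.V) : t = 0 ∨ t = δ.length := by
  by_contra! hne
  exact δ.interior t ⟨lt_of_le_of_ne ht.1 (Ne.symm hne.1), lt_of_le_of_ne ht.2 hne.2⟩ h

theorem Dart.inj (δ δ' : M.Dart) {s t : ℝ} (hs : s ∈ Ioo 0 δ.length) (ht : t ∈ Ioo 0 δ'.length)
    (h : δ.arc s = δ'.arc t) : δ.1 = δ'.1 := by
  have aux : ∀ (δ : M.Dart) (s : ℝ), s ∈ Ioo 0 δ.length →
      (if δ.2 then M.len δ.1 - s else s) ∈ Ioo 0 (M.len δ.1) := by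
    rintro ⟨e, _ | _⟩ s hs
    · simpa [Dart.length] using hs
    · simp only [Dart.length] at hs
      exact ⟨by simpa using hs.2, by simpa using hs.1⟩
  exact M.inj _ _ _ (aux δ s hs) _ (aux δ' t ht) h

theorem Dart.base_ne_tip (δ : M.Dart) : δ.base ≠ δ.tip := by
  rw [← dist_pos, ← δ.arc_length, ← δ.arc_zero,
    δ.isom _ ⟨le_rfl, δ.length_pos.le⟩ _ ⟨δ.length_pos.le, le_rfl⟩, zero_sub, abs_neg,
    abs_of_pos δ.length_pos]
  exact δ.length_pos

theorem Dart.eq_of_fst {δ δ' : M.Dart} (h : δ.1 = δ'.1) : δ' = δ ∨ δ' = δ.opp := by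
  obtain ⟨e, b⟩ := δ
  obtain ⟨e', b'⟩ := δ'
  obtain rfl : e = e' := h
  cases b <;> cases b' <;> simp [Dart.opp]

theorem exists_dart (x : Γ) (hx : x ∉ M.V) : ∃ δ : M.Dart, ∃ t ∈ Ioo 0 δ.length, δ.arc t = x := by
  obtain ⟨e, t, ht, rfl⟩ := M.cover x hx
  exact ⟨(e, false), t, ht, by simp [Dart.arc]⟩

theorem Dart.isClosed_image (δ : M.Dart) {a b : ℝ} (ha : 0 ≤ a) (hb : b ≤ δ.length) :
    IsClosed (δ.arc '' Icc a b) :=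
  (isCompact_Icc.image_of_continuousOn
    ((continuousOn_of_dist_eq δ.isom).mono (Icc_subset_Icc ha hb))).isClosed

theorem Dart.isOpen_image (δ : M.Dart) : IsOpen (δ.arc '' Ioo 0 δ.length) := by
  have : δ.arc '' Ioo 0 δ.length =
      ((M.V : Set Γ) ∪ ⋃ δ' : {δ' : M.Dart // δ'.1 ≠ δ.1}, δ'.1.arc '' Icc 0 δ'.1.length)ᶜ := by
    ext x
    simp only [mem_compl_iff, mem_union, not_or]
    constructor
    · rintro ⟨t, ht, rfl⟩
      refine ⟨δ.interior t ht, fun h => ?_⟩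
      obtain ⟨⟨δ', hne⟩, s, hs, he⟩ := mem_iUnion.1 h
      have hs' : s ∈ Ioo 0 δ'.length := by
        refine ⟨lt_of_le_of_ne hs.1 ?_, lt_of_le_of_ne hs.2 ?_⟩
        · rintro rfl
          exact δ.interior t ht (he ▸ δ'.base_mem)
        · rintro rfl
          exact δ.interior t ht (he ▸ δ'.arc_length ▸ δ'.tip_mem)
      exact hne (Dart.inj _ _ hs' ht he)
    · rintro ⟨hV, hx⟩
      obtain ⟨δ', t, ht, rfl⟩ := M.exists_dart x hV
      by_cases hne : δ'.1 = δ.1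
      · rcases Dart.eq_of_fst hne.symm with rfl | rfl
        · exact ⟨t, ht, rfl⟩
        · rw [Dart.length_opp] at ht
          exact ⟨δ.length - t, ⟨by linarith [ht.2], by linarith [ht.1]⟩, (δ.opp_arc t).symm⟩
      · exact (hx (mem_iUnion.2 ⟨⟨δ', hne⟩, t, ⟨ht.1.le, ht.2.le⟩, rfl⟩)).elim
  rw [this]
  exact (M.V.finite_toSet.isClosed.union (isClosed_iUnion_of_finite fun δ' =>
    δ'.1.isClosed_image le_rfl le_rfl)).isOpen_compl

theorem isStar_vertex {v : Γ} (hv : v ∈ M.V) :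
    IsStar v (fun δ : {δ : M.Dart // δ.base = v} => δ.1.arc) fun δ => δ.1.length where
  pos δ := δ.1.length_pos
  zero δ := δ.2
  isom δ := δ.1.isom
  inj := by
    rintro ⟨δ, hδ⟩ ⟨δ', hδ'⟩ s hs t ht he
    rcases Dart.eq_of_fst (Dart.inj δ δ' hs ht he) with rfl | rfl
    · rfl
    · exact absurd (hδ.trans hδ'.symm) δ.base_ne_tip
  cover := by
    let C : Set Γ := ((M.V : Set Γ) \ {v}) ∪
      ⋃ δ : {δ : M.Dart // δ.base ≠ v ∧ δ.tip ≠ v}, δ.1.arc '' Icc 0 δ.1.length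
    have hC : IsClosed C := ((M.V.finite_toSet.subset sdiff_subset).isClosed).union
      (isClosed_iUnion_of_finite fun δ => δ.1.isClosed_image le_rfl le_rfl)
    have hvC : v ∉ C := by
      rintro (h | h)
      · exact h.2 rfl
      · obtain ⟨⟨δ, h1, h2⟩, t, ht, he⟩ := mem_iUnion.1 h
        rcases δ.eq_or_eq_of_mem ht (he ▸ hv) with rfl | rfl
        · exact h1 he
        · exact h2 (δ.arc_length ▸ he)
    obtain ⟨ε, hε, hball⟩ := Metric.isOpen_iff.1 hC.isOpen_compl v hvC
    refine ⟨ε, hε, fun x hx hxv => ?_⟩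
    have hxC := hball hx
    have hxV : x ∉ M.V := fun h => hxC (Or.inl ⟨h, hxv⟩)
    obtain ⟨δ, t, ht, rfl⟩ := M.exists_dart x hxV
    by_cases h1 : δ.base = v
    · exact ⟨⟨δ, h1⟩, t, ht, rfl⟩
    · by_cases h2 : δ.tip = v
      · refine ⟨⟨δ.opp, h2⟩, δ.length - t, ⟨?_, ?_⟩, ?_⟩
        · linarith [ht.2]
        · show δ.length - t < δ.length
          linarith [ht.1]
        · simp [Dart.opp_arc]
      · exact (hxC (Or.inr (mem_iUnion.2 ⟨⟨δ, h1, h2⟩, t, ⟨ht.1.le, ht.2.le⟩, rfl⟩))).elim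

theorem Dart.isStar_interior (δ : M.Dart) {t : ℝ} (ht : t ∈ Ioo 0 δ.length) :
    IsStar (δ.arc t) (fun b : Bool => fun s => δ.arc (if b then t - s else t + s))
      fun b => if b then t else δ.length - t where
  pos b := by cases b <;> simp [ht.1, ht.2]
  zero b := by cases b <;> simp
  isom b := by
    cases b
    · intro x hx y hy
      simp only [Bool.false_eq_true, if_false] at hx hy ⊢
      rw [δ.isom _ ⟨by linarith [hx.1, ht.1], by linarith [hx.2]⟩ _
        ⟨by linarith [hy.1, ht.1], by linarith [hy.2]⟩]
      congr 1
      ring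
    · intro x hx y hy
      simp only [if_true] at hx hy ⊢
      rw [δ.isom _ ⟨by linarith [hx.2], by linarith [hx.1, ht.2]⟩ _
        ⟨by linarith [hy.2], by linarith [hy.1, ht.2]⟩, abs_sub_comm]
      congr 1
      ring
  inj := by
    have hinj : ∀ x ∈ Icc 0 δ.length, ∀ y ∈ Icc 0 δ.length, δ.arc x = δ.arc y → x = y := by
      intro x hx y hy he
      have := δ.isom x hx y hy
      rwa [he, dist_self, eq_comm, abs_eq_zero, sub_eq_zero] at this
    rintro (_ | _) (_ | _) x hx y hy he <;> simp only [Bool.false_eq_true, if_false, if_true] at *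
    · have := hinj _ ⟨by linarith [hx.1, ht.1], by linarith [hx.2]⟩ _
        ⟨by linarith [hy.2], by linarith [hy.1, ht.2]⟩ he
      linarith [hx.1, hy.1]
    · have := hinj _ ⟨by linarith [hx.2], by linarith [hx.1, ht.2]⟩ _
        ⟨by linarith [hy.1, ht.1], by linarith [hy.2]⟩ he
      linarith [hx.1, hy.1]
  cover := by
    obtain ⟨ε, hε, hball⟩ := Metric.isOpen_iff.1 δ.isOpen_image (δ.arc t) ⟨t, ht, rfl⟩
    refine ⟨ε, hε, fun x hx hxt => ?_⟩
    obtain ⟨s, hs, rfl⟩ := hball hx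
    rcases lt_trichotomy s t with h | rfl | h
    · refine ⟨true, t - s, ⟨?_, ?_⟩, ?_⟩
      · linarith
      · simp only [if_true]; linarith [hs.1]
      · simp
    · exact absurd rfl hxt
    · refine ⟨false, s - t, ⟨?_, ?_⟩, ?_⟩
      · linarith
      · simp only [Bool.false_eq_true, if_false]; linarith [hs.2]
      · simp

/-- A property of vertices which propagates along edges holds for all vertices. -/
theorem forall_of_step [ConnectedSpace Γ] {C : Γ → Prop} {P₀ : Γ} (hP₀ : P₀ ∈ M.V) (h₀ : C P₀)
    (hstep : ∀ δ : M.Dart, C δ.base → C δ.tip) : ∀ v ∈ M.V, C v := by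
  have hstep' : ∀ δ : M.Dart, C δ.base ↔ C δ.tip := fun δ =>
    ⟨hstep δ, fun h => by simpa using hstep δ.opp h⟩
  let X : (Γ → Prop) → Set Γ := fun Q => {v | v ∈ M.V ∧ Q v} ∪
    ⋃ δ : {δ : M.Dart // Q δ.base}, δ.1.arc '' Icc 0 δ.1.length
  have hX : ∀ Q, IsClosed (X Q) := fun Q =>
    ((M.V.finite_toSet.subset fun v hv => hv.1).isClosed).union
      (isClosed_iUnion_of_finite fun δ => δ.1.isClosed_image le_rfl le_rfl)
  have hV : ∀ Q, (∀ δ : M.Dart, Q δ.base → Q δ.tip) → ∀ x ∈ M.V, x ∈ X Q → Q x := by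
    rintro Q hQ x hx (h | h)
    · exact h.2
    · obtain ⟨⟨δ, hδ⟩, t, ht, rfl⟩ := mem_iUnion.1 h
      rcases δ.eq_or_eq_of_mem ht hx with rfl | rfl
      · exact hδ
      · exact δ.arc_length ▸ hQ δ hδ
  have hI : ∀ Q, (∀ δ : M.Dart, Q δ.base → Q δ.tip) → ∀ x ∉ M.V, x ∈ X Q →
      ∃ δ : M.Dart, Q δ.base ∧ Q δ.tip ∧ ∃ t ∈ Ioo 0 δ.length, δ.arc t = x := by
    rintro Q hQ x hx (h | h)
    · exact absurd h.1 hx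
    · obtain ⟨⟨δ, hδ⟩, t, ht, rfl⟩ := mem_iUnion.1 h
      refine ⟨δ, hδ, hQ δ hδ, t, ⟨lt_of_le_of_ne ht.1 ?_, lt_of_le_of_ne ht.2 ?_⟩, rfl⟩
      · rintro rfl; exact hx δ.base_mem
      · rintro rfl; exact hx (δ.arc_length ▸ δ.tip_mem)
  intro v hv
  by_contra hCv
  obtain ⟨x, -, hx1, hx2⟩ := isPreconnected_closed_iff.1 (isPreconnected_univ (α := Γ))
    (X C) (X fun w => ¬ C w) (hX _) (hX _)
    (fun x _ => by
      by_cases hx : x ∈ M.V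
      · by_cases hC : C x
        · exact Or.inl (Or.inl ⟨hx, hC⟩)
        · exact Or.inr (Or.inl ⟨hx, hC⟩)
      · obtain ⟨δ, t, ht, rfl⟩ := M.exists_dart x hx
        have ht' : t ∈ Icc 0 δ.length := ⟨ht.1.le, ht.2.le⟩
        by_cases hC : C δ.base
        · exact Or.inl (Or.inr (mem_iUnion.2 ⟨⟨δ, hC⟩, t, ht', rfl⟩))
        · exact Or.inr (Or.inr (mem_iUnion.2 ⟨⟨δ, hC⟩, t, ht', rfl⟩)))
    ⟨P₀, mem_univ _, Or.inl ⟨hP₀, h₀⟩⟩ ⟨v, mem_univ _, Or.inl ⟨hv, hCv⟩⟩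
  have hn : ∀ δ : M.Dart, ¬ C δ.base → ¬ C δ.tip := fun δ h h' => h ((hstep' δ).2 h')
  by_cases hx : x ∈ M.V
  · exact hV _ hn x hx hx2 (hV C hstep x hx hx1)
  · obtain ⟨δ, h1, h2, t, ht, he⟩ := hI C hstep x hx hx1
    obtain ⟨δ', h1', h2', t', ht', he'⟩ := hI _ hn x hx hx2
    rcases Dart.eq_of_fst (Dart.inj δ δ' ht ht' (he.trans he'.symm)) with rfl | rfl
    · exact h1' h1
    · exact h1' h2

end GraphModel

section RealSlopes

variable {u : ℝ → ℝ} {ℓ t : ℝ}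

theorem convexOn_of_hasSlopeAlong (hu : ContinuousOn u (Icc 0 ℓ))
    (h : ∀ t ∈ Ioo 0 ℓ, ∃ s s' : ℤ, 0 ≤ s + s' ∧ HasSlopeAlong u (fun x => t + x) s ∧
      HasSlopeAlong u (fun x => t - x) s') : ConvexOn ℝ (Icc 0 ℓ) u := by
  refine LinearOrder.convexOn_of_lt (convex_Icc 0 ℓ) ?_
  intro a ha b hb hab p q hp hq hpq
  simp only [smul_eq_mul]
  by_contra! hlt
  have hba : 0 < b - a := sub_pos.2 hab
  let c := (u b - u a) / (b - a)
  have hc : c * (b - a) = u b - u a := div_mul_cancel₀ _ hba.ne'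
  set y := p * a + q * b with hy
  have hya : y - a = q * (b - a) := by rw [hy, eq_sub_of_add_eq hpq]; ring
  have hyb : b - y = p * (b - a) := by rw [hy, eq_sub_of_add_eq' hpq]; ring
  have hay : a < y := by nlinarith
  have hyb' : y < b := by nlinarith
  have hw : 0 < u y - u a - c * (y - a) := by
    rw [hya, mul_left_comm, hc]
    rw [eq_sub_of_add_eq hpq] at hlt
    linarith
  obtain ⟨η, hη, hηy⟩ : ∃ η > 0, 0 < u y - u a - c * (y - a) + η * ((y - a) * (y - b)) := by
    have hpos : 0 < (y - a) * (b - y) := mul_pos (sub_pos.2 hay) (sub_pos.2 hyb')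
    refine ⟨(u y - u a - c * (y - a)) / (2 * ((y - a) * (b - y))), by positivity, ?_⟩
    have : (u y - u a - c * (y - a)) / (2 * ((y - a) * (b - y))) * ((y - a) * (y - b)) =
        -((u y - u a - c * (y - a)) / 2) := by
      have h1 : y - a ≠ 0 := (sub_pos.2 hay).ne'
      have h2 : b - y ≠ 0 := (sub_pos.2 hyb').ne'
      field_simp
      ring
    rw [this]
    linarith
  let w : ℝ → ℝ := fun x => u x - u a - c * (x - a) + η * ((x - a) * (x - b))
  have hsub : Icc a b ⊆ Icc 0 ℓ := Icc_subset_Icc ha.1 hb.2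
  have hwc : ContinuousOn w (Icc a b) := by
    have := hu.mono hsub
    fun_prop
  obtain ⟨z, hz, hmax⟩ := isCompact_Icc.exists_isMaxOn ⟨y, hay.le, hyb'.le⟩ hwc
  have hwz : 0 < w z := hηy.trans_le (hmax (show y ∈ Icc a b from ⟨hay.le, hyb'.le⟩))
  have hza : a < z := by
    refine lt_of_le_of_ne hz.1 ?_
    rintro rfl
    simp [w] at hwz
  have hzb : z < b := by
    refine lt_of_le_of_ne hz.2 ?_
    rintro rfl
    simp [w, hc] at hwz
  obtain ⟨s, s', hss, ⟨ε, hε, h1⟩, ⟨ε', hε', h2⟩⟩ :=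
    h z ⟨ha.1.trans_lt hza, hzb.trans_le hb.2⟩
  obtain ⟨x, hx, hxε, hxε', hxa, hxb⟩ : ∃ x > 0, x ≤ ε ∧ x ≤ ε' ∧ x ≤ z - a ∧ x ≤ b - z :=
    ⟨min (min ε ε') (min (z - a) (b - z)),
      lt_min (lt_min hε hε') (lt_min (sub_pos.2 hza) (sub_pos.2 hzb)),
      (min_le_left _ _).trans (min_le_left _ _), (min_le_left _ _).trans (min_le_right _ _),
      (min_le_right _ _).trans (min_le_left _ _), (min_le_right _ _).trans (min_le_right _ _)⟩
  have h3 : w (z + x) ≤ w z := hmax (show z + x ∈ Icc a b from ⟨by linarith, by linarith⟩)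
  have h4 : w (z - x) ≤ w z := hmax (show z - x ∈ Icc a b from ⟨by linarith, by linarith⟩)
  have h1' := h1 x ⟨hx.le, hxε⟩
  have h2' := h2 x ⟨hx.le, hxε'⟩
  simp only [add_zero, sub_zero] at h1' h2'
  simp only [w, h1', h2'] at h3 h4
  have hss' : (0 : ℝ) ≤ s + s' := by exact_mod_cast hss
  nlinarith [mul_nonneg hss' hx.le, mul_pos hη (mul_pos hx hx)]

theorem ConvexOn.le_of_hasSlopeAlong (hu : ConvexOn ℝ (Icc 0 ℓ) u) (ht : t ∈ Ico 0 ℓ) {s : ℤ}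
    (hs : HasSlopeAlong u (fun x => t + x) s) {y : ℝ} (hy : y ∈ Icc 0 ℓ) :
    u t + s * (y - t) ≤ u y := by
  obtain ⟨ε, hε, h⟩ := hs
  simp only [add_zero] at h
  rcases lt_trichotomy y t with hyt | rfl | hyt
  · obtain ⟨x, hx, hxε, hxℓ⟩ : ∃ x > 0, x ≤ ε ∧ x ≤ ℓ - t :=
      ⟨min ε (ℓ - t), lt_min hε (sub_pos.2 ht.2), min_le_left _ _, min_le_right _ _⟩
    have := hu.slope_mono_adjacent hy (z := t + x) ⟨by linarith [ht.1], by linarith⟩ hyt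
      (by linarith)
    rw [h x ⟨hx.le, hxε⟩, add_sub_cancel_left, add_sub_cancel_left,
      mul_div_cancel_right₀ _ hx.ne', div_le_iff₀ (sub_pos.2 hyt)] at this
    linarith
  · simp
  · obtain ⟨x, hx, hxε, hxy⟩ : ∃ x > 0, x ≤ ε ∧ x ≤ y - t :=
      ⟨min ε (y - t), lt_min hε (sub_pos.2 hyt), min_le_left _ _, min_le_right _ _⟩
    have := hu.secant_mono (a := t) (x := t + x) (y := y) ⟨ht.1, ht.2.le⟩
      ⟨by linarith [ht.1], by linarith [hy.2]⟩ hy (by linarith) hyt.ne' (by linarith)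
    rw [h x ⟨hx.le, hxε⟩, add_sub_cancel_left, add_sub_cancel_left,
      mul_div_cancel_right₀ _ hx.ne', le_div_iff₀ (sub_pos.2 hyt)] at this
    linarith

theorem hasSlopeAlong_max_affine {i j : ℤ} (α β : ℝ) (hij : i ≤ j) (t : ℝ) :
    ∃ s s' : ℤ, 0 ≤ s + s' ∧
      HasSlopeAlong (fun x : ℝ => max (α + i * x) (β + j * x)) (fun x => t + x) s ∧
      HasSlopeAlong (fun x : ℝ => max (α + i * x) (β + j * x)) (fun x => t - x) s' := by
  have hij' : (i : ℝ) ≤ j := by exact_mod_cast hij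
  have hpos : (0 : ℝ) < j - i + 1 := by linarith
  rcases lt_trichotomy (α + i * t) (β + j * t) with h | h | h
  · have key : ∀ x : ℝ, |x| ≤ ((β + j * t) - (α + i * t)) / (j - i + 1) →
        max (α + i * (t + x)) (β + j * (t + x)) = β + j * (t + x) := by
      intro x hx
      rw [le_div_iff₀ hpos] at hx
      have := neg_abs_le x
      refine max_eq_right ?_
      nlinarith [abs_nonneg x]
    have hε : 0 < ((β + j * t) - (α + i * t)) / (j - i + 1) := div_pos (sub_pos.2 h) hpos
    refine ⟨j, -j, by simp, ⟨_, hε, fun x hx => ?_⟩, ⟨_, hε, fun x hx => ?_⟩⟩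
    · have h1 := key x (by rw [abs_of_nonneg hx.1]; exact hx.2)
      have h0 := key 0 (by simpa using hε.le)
      simp only [h1, h0]
      ring
    · have h1 := key (-x) (by rw [abs_neg, abs_of_nonneg hx.1]; exact hx.2)
      have h0 := key 0 (by simpa using hε.le)
      simp only [add_zero] at h0
      simp only [sub_eq_add_neg, neg_zero, add_zero, h1, h0]
      push_cast
      ring
  · refine ⟨j, -i, by linarith, ⟨1, one_pos, fun x hx => ?_⟩, ⟨1, one_pos, fun x hx => ?_⟩⟩
    · simp only [add_zero, h, max_self]
      rw [max_eq_right (by nlinarith [hx.1])]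
      ring
    · simp only [sub_zero, ← h, max_self]
      rw [max_eq_left (by nlinarith [hx.1])]
      push_cast
      ring
  · have key : ∀ x : ℝ, |x| ≤ ((α + i * t) - (β + j * t)) / (j - i + 1) →
        max (α + i * (t + x)) (β + j * (t + x)) = α + i * (t + x) := by
      intro x hx
      rw [le_div_iff₀ hpos] at hx
      have := le_abs_self x
      refine max_eq_left ?_
      nlinarith [abs_nonneg x]
    have hε : 0 < ((α + i * t) - (β + j * t)) / (j - i + 1) := div_pos (sub_pos.2 h) hpos
    refine ⟨i, -i, by simp, ⟨_, hε, fun x hx => ?_⟩, ⟨_, hε, fun x hx => ?_⟩⟩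
    · have h1 := key x (by rw [abs_of_nonneg hx.1]; exact hx.2)
      have h0 := key 0 (by simpa using hε.le)
      simp only [h1, h0]
      ring
    · have h1 := key (-x) (by rw [abs_neg, abs_of_nonneg hx.1]; exact hx.2)
      have h0 := key 0 (by simpa using hε.le)
      simp only [add_zero] at h0
      simp only [sub_eq_add_neg, neg_zero, add_zero, h1, h0]
      push_cast
      ring

end RealSlopes

theorem IsMetricGraph.exists_hasOrderAt {Γ : Type} [MetricSpace Γ] (hΓ : IsMetricGraph Γ)
    {f : Γ → ℝ} (hf : IsRational Γ f) (P : Γ) : ∃ m, HasOrderAt Γ f P m := by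
  obtain ⟨τ, r, h⟩ := hΓ.exists_isStar P
  choose s hs using fun i => hf.2 P (τ i) (h.isDirections.arc i)
  exact ⟨_, h.isDirections.hasOrderAt hs⟩

namespace GraphModel

variable {Γ : Type} [MetricSpace Γ] {M : GraphModel Γ}

theorem Dart.hasSlopeAlong_of_eqOn {δ : M.Dart} {f : Γ → ℝ} {u : ℝ → ℝ}
    (hu : ∀ x ∈ Icc 0 δ.length, f (δ.arc x) = u x) {t : ℝ} (ht : t ∈ Ico 0 δ.length) {s : ℤ}
    (hs : HasSlopeAlong u (fun x => t + x) s) : HasSlopeAlong f (fun x => δ.arc (t + x)) s := by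
  obtain ⟨ε, hε, h⟩ := hs
  refine ⟨min ε (δ.length - t), lt_min hε (sub_pos.2 ht.2), fun x hx => ?_⟩
  have h1 := hx.2.trans (min_le_left _ _)
  have h2 := hx.2.trans (min_le_right _ _)
  simp only [add_zero] at h ⊢
  rw [hu _ ⟨by linarith [hx.1, ht.1], by linarith⟩, hu _ ⟨ht.1, ht.2.le⟩, h x ⟨hx.1, h1⟩]

theorem Dart.opp_arc_add (δ : M.Dart) (t : ℝ) :
    (fun x => δ.opp.arc (δ.length - t + x)) = fun x => δ.arc (t - x) := by
  ext x
  rw [Dart.opp_arc]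
  congr 1
  ring

theorem Dart.exists_hasSlopeAlong (δ : M.Dart) {f : Γ → ℝ} (hf : IsRational Γ f) {t : ℝ}
    (ht : t ∈ Ico 0 δ.length) : ∃ s, HasSlopeAlong f (fun x => δ.arc (t + x)) s := by
  refine hf.2 (δ.arc t) _ ⟨by simp, δ.length - t, sub_pos.2 ht.2, fun x hx y hy => ?_⟩
  rw [δ.isom _ ⟨by linarith [hx.1, ht.1], by linarith [hx.2]⟩ _
    ⟨by linarith [hy.1, ht.1], by linarith [hy.2]⟩]
  congr 1
  ring

theorem Dart.exists_hasSlopeAlong_sub (δ : M.Dart) {f : Γ → ℝ} (hf : IsRational Γ f) {t : ℝ}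
    (ht : t ∈ Ioc 0 δ.length) : ∃ s, HasSlopeAlong f (fun x => δ.arc (t - x)) s := by
  rw [← δ.opp_arc_add]
  exact δ.opp.exists_hasSlopeAlong hf ⟨by linarith [ht.2], by rw [length_opp]; linarith [ht.1]⟩

theorem Dart.eq_add_of_hasOrderAt (δ : M.Dart) {f : Γ → ℝ} {t : ℝ}
    (ht : t ∈ Ioo 0 δ.length) {m s s' : ℤ} (hm : HasOrderAt Γ f (δ.arc t) m)
    (hs : HasSlopeAlong f (fun x => δ.arc (t + x)) s)
    (hs' : HasSlopeAlong f (fun x => δ.arc (t - x)) s') : m = s + s' := by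
  have := hm.eq_sum (δ.isStar_interior ht).isDirections (s := fun b => if b then s' else s)
    (by rintro (_ | _) <;> simpa)
  simpa [add_comm] using this

theorem isRational_of_forall_dart {f : Γ → ℝ}
    (h : ∀ δ : M.Dart, ∀ t ∈ Ico 0 δ.length, ∃ s, HasSlopeAlong f (fun x => δ.arc (t + x)) s) :
    IsRational Γ f := by
  have key : ∀ P, ContinuousAt f P ∧ ∀ σ, IsArcAt P σ → ∃ s, HasSlopeAlong f σ s := by
    intro P
    by_cases hP : P ∈ M.V
    · choose s hs using fun δ : M.Dart => h δ 0 ⟨le_rfl, δ.length_pos⟩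
      simp only [zero_add] at hs
      have hs' : ∀ δ : {δ : M.Dart // δ.base = P}, HasSlopeAlong f δ.1.arc (s δ.1) :=
        fun δ => hs δ.1
      exact ⟨(isStar_vertex hP).continuousAt hs',
        fun σ hσ => (isStar_vertex hP).exists_hasSlopeAlong hs' hσ⟩
    · obtain ⟨δ, t, ht, rfl⟩ := M.exists_dart P hP
      obtain ⟨s, hs⟩ := h δ t ⟨ht.1.le, ht.2⟩
      obtain ⟨s', hs'⟩ := h δ.opp (δ.length - t)
        ⟨by linarith [ht.2], by rw [Dart.length_opp]; linarith [ht.1]⟩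
      rw [δ.opp_arc_add] at hs'
      have hb : ∀ b : Bool, HasSlopeAlong f (fun x => δ.arc (if b then t - x else t + x))
          (if b then s' else s) := by
        rintro (_ | _) <;> simpa
      exact ⟨(δ.isStar_interior ht).continuousAt hb,
        fun σ hσ => (δ.isStar_interior ht).exists_hasSlopeAlong hb hσ⟩
  exact ⟨continuous_iff_continuousAt.2 fun P => (key P).1, fun P => (key P).2⟩

end GraphModel

theorem IsMetricGraph.exists_divisor {Γ : Type} [MetricSpace Γ] (hΓ : IsMetricGraph Γ)
    {f : Γ → ℝ} (hf : IsRational Γ f) : ∃ d : Divisor Γ, ∀ P, HasOrderAt Γ f P (d P) := by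
  have := hΓ.1
  choose d hd using hΓ.exists_hasOrderAt hf
  have hloc : ∀ P, ∃ ε > 0, ∀ x ∈ Metric.ball P ε, x ≠ P → d x = 0 := by
    intro P
    obtain ⟨M, hM⟩ := hΓ.exists_model {P}
    have hP : P ∈ M.V := hM (Finset.mem_singleton_self P)
    have hstar := M.isStar_vertex hP
    choose s η hη hs using fun δ : {δ : M.Dart // δ.base = P} =>
      hf.2 P δ.1.arc (hstar.isDirections.arc δ)
    obtain ⟨c, hc, hcη⟩ := exists_pos_forall_lt hη
    obtain ⟨ε, hε, hcov⟩ := hstar.cover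
    refine ⟨min ε c, lt_min hε hc, fun x hx hxP => ?_⟩
    rw [Metric.mem_ball, lt_min_iff] at hx
    obtain ⟨δ, t, ht, rfl⟩ := hcov x hx.1 hxP
    have htc : t < c := by
      rw [hstar.dist_eq (i := δ) ⟨ht.1.le, ht.2.le⟩] at hx
      exact hx.2
    have hlt := htc.trans (hcη δ)
    have h0 := hs δ t ⟨ht.1.le, hlt.le⟩
    refine (δ.1.eq_add_of_hasOrderAt ht (hd _) (s := s δ) (s' := -s δ) ⟨η δ - t,
      sub_pos.2 hlt, fun x hx => ?_⟩ ⟨t, ht.1, fun x hx => ?_⟩).trans (by simp)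
    · simp only [add_zero]
      rw [hs δ _ ⟨by linarith [ht.1, hx.1], by linarith [hx.2]⟩, h0]
      ring
    · simp only [sub_zero]
      rw [hs δ _ ⟨by linarith [hx.2], by linarith [hx.1]⟩, h0]
      push_cast
      ring
  choose ε hε hzero using hloc
  obtain ⟨F, hF⟩ := CompactSpace.elim_nhds_subcover (fun P => Metric.ball P (ε P))
    fun P => Metric.ball_mem_nhds P (hε P)
  have hsupp : (Function.support d).Finite := by
    refine F.finite_toSet.subset fun x hx => ?_
    obtain ⟨P, hP, hxP⟩ := mem_iUnion₂.1 (hF ▸ mem_univ x : x ∈ ⋃ P ∈ F, Metric.ball P (ε P))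
    by_contra hxF
    exact hx (hzero P x hxP (by rintro rfl; exact hxF hP))
  exact ⟨Finsupp.ofSupportFinite d hsupp, hd⟩

namespace GraphModel

variable {Γ : Type} [MetricSpace Γ] {M : GraphModel Γ}

/-- The average slope of `φ` along an edge. -/
noncomputable def Dart.slope (δ : M.Dart) (φ : Γ → ℝ) : ℝ := (φ δ.tip - φ δ.base) / δ.length

theorem Dart.slope_opp (δ : M.Dart) (φ : Γ → ℝ) : δ.opp.slope φ = -δ.slope φ := by
  simp only [Dart.slope, tip_opp, base_opp, length_opp]
  ring

theorem Dart.slope_mul_length (δ : M.Dart) (φ : Γ → ℝ) :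
    δ.slope φ * δ.length = φ δ.tip - φ δ.base :=
  div_mul_cancel₀ _ δ.length_pos.ne'

/-- The largest convex function with integer slopes on an edge with prescribed boundary
values. -/
noncomputable def Dart.hat (δ : M.Dart) (φ : Γ → ℝ) (t : ℝ) : ℝ :=
  max (φ δ.base + ⌊δ.slope φ⌋ * t) (φ δ.tip + ⌊-δ.slope φ⌋ * (δ.length - t))

theorem Dart.hat_opp (δ : M.Dart) (φ : Γ → ℝ) (t : ℝ) :
    δ.opp.hat φ t = δ.hat φ (δ.length - t) := by
  simp only [Dart.hat, slope_opp, tip_opp, base_opp, length_opp, neg_neg, sub_sub_cancel]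
  rw [max_comm]

theorem Dart.hat_zero (δ : M.Dart) (φ : Γ → ℝ) : δ.hat φ 0 = φ δ.base := by
  have h1 := mul_le_mul_of_nonneg_right (Int.floor_le (-δ.slope φ)) δ.length_pos.le
  have h2 := δ.slope_mul_length φ
  simp only [Dart.hat, mul_zero, add_zero, sub_zero]
  exact max_eq_left (by linarith)

theorem Dart.hat_length (δ : M.Dart) (φ : Γ → ℝ) : δ.hat φ δ.length = φ δ.tip := by
  have := δ.opp.hat_zero φ
  rwa [hat_opp, sub_zero, base_opp] at this

theorem floor_le_neg_floor_neg (q : ℝ) : ⌊q⌋ ≤ -⌊-q⌋ := by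
  have h1 := Int.floor_le q
  have h2 := Int.floor_le (-q)
  have : ((⌊q⌋ + ⌊-q⌋ : ℤ) : ℝ) ≤ 0 := by push_cast; linarith
  have := Int.cast_nonpos.1 this
  linarith

theorem Dart.hat_eq (δ : M.Dart) (φ : Γ → ℝ) : δ.hat φ = fun t =>
    max (φ δ.base + ⌊δ.slope φ⌋ * t)
      (φ δ.tip + ⌊-δ.slope φ⌋ * δ.length + ((-⌊-δ.slope φ⌋ : ℤ) : ℝ) * t) := by
  ext t
  rw [Dart.hat]
  congr 1
  push_cast
  ring

theorem Dart.exists_hat_slopes (δ : M.Dart) (φ : Γ → ℝ) (t : ℝ) : ∃ s s' : ℤ, 0 ≤ s + s' ∧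
    HasSlopeAlong (δ.hat φ) (fun x => t + x) s ∧ HasSlopeAlong (δ.hat φ) (fun x => t - x) s' := by
  rw [Dart.hat_eq]
  exact hasSlopeAlong_max_affine _ _ (floor_le_neg_floor_neg _) t

theorem Dart.hat_slope_zero (δ : M.Dart) (φ : Γ → ℝ) :
    HasSlopeAlong (δ.hat φ) (fun x => 0 + x) ⌊δ.slope φ⌋ := by
  have hmul := δ.slope_mul_length φ
  have hℓ := δ.length_pos
  have h1 := Int.floor_le (-δ.slope φ)
  rcases h1.lt_or_eq with h1 | h1
  · have hpos : (0 : ℝ) < |((-⌊-δ.slope φ⌋ : ℤ) : ℝ) - ⌊δ.slope φ⌋| + 1 := by positivity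
    have hgap : 0 < (-δ.slope φ - ⌊-δ.slope φ⌋) * δ.length := mul_pos (sub_pos.2 h1) hℓ
    refine ⟨_, div_pos hgap hpos, fun x hx => ?_⟩
    have hx2 := hx.2
    rw [le_div_iff₀ hpos] at hx2
    simp only [zero_add]
    rw [δ.hat_zero, Dart.hat]
    have := neg_abs_le (((-⌊-δ.slope φ⌋ : ℤ) : ℝ) - ⌊δ.slope φ⌋)
    have h3 := le_abs_self (((-⌊-δ.slope φ⌋ : ℤ) : ℝ) - ⌊δ.slope φ⌋)
    refine max_eq_left ?_
    push_cast at this hx2 h3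
    nlinarith [hx.1]
  · have hq : δ.slope φ = ((-⌊-δ.slope φ⌋ : ℤ) : ℝ) := by push_cast; linarith
    have hf : ⌊δ.slope φ⌋ = -⌊-δ.slope φ⌋ := by
      conv_lhs => rw [hq]
      exact Int.floor_intCast _
    refine ⟨1, one_pos, fun x _ => ?_⟩
    simp only [zero_add]
    rw [δ.hat_zero, Dart.hat, hf]
    push_cast
    rw [max_eq_left]
    have : δ.slope φ = -⌊-δ.slope φ⌋ := by linarith
    nlinarith

variable (M) in
/-- The sum of the numbers `m δ` over the darts `δ` emanating from `v`. -/
noncomputable def sumAt {A : Type} [AddCommMonoid A] (m : M.Dart → A) (v : Γ) : A :=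
  open Classical in ∑ δ with δ.base = v, m δ

theorem sumAt_eq {A : Type} [AddCommMonoid A] (m : M.Dart → A) (v : Γ)
    [Fintype {δ : M.Dart // δ.base = v}] :
    M.sumAt m v = ∑ δ : {δ : M.Dart // δ.base = v}, m δ.1 := by
  classical
  rw [sumAt]
  exact Finset.sum_subtype _ (by simp) _

theorem sum_sumAt {A : Type} [AddCommMonoid A] (m : M.Dart → A) :
    ∑ v ∈ M.V, M.sumAt m v = ∑ δ, m δ := by
  classical
  exact Finset.sum_fiberwise_of_maps_to (fun δ _ => δ.base_mem) m

theorem Dart.sum_opp {A : Type} [AddCommMonoid A] (m : M.Dart → A) :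
    ∑ δ : M.Dart, m δ.opp = ∑ δ, m δ :=
  Equiv.sum_comp ⟨Dart.opp, Dart.opp, Dart.opp_opp, Dart.opp_opp⟩ m

theorem sum_nonpos_of_le_slope {m : M.Dart → ℤ} {φ : Γ → ℝ} (hm : ∀ δ, m δ ≤ δ.slope φ) :
    ∑ δ, m δ ≤ 0 := by
  have h0 : ∑ δ : M.Dart, δ.slope φ = 0 := by
    have := Dart.sum_opp (fun δ : M.Dart => δ.slope φ)
    simp only [Dart.slope_opp, Finset.sum_neg_distrib] at this
    linarith
  have : ((∑ δ, m δ : ℤ) : ℝ) ≤ 0 := by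
    push_cast
    exact (Finset.sum_le_sum fun δ _ => hm δ).trans h0.le
  exact_mod_cast this

section Rational

variable {f : Γ → ℝ} {d : Γ → ℤ}

theorem Dart.convexOn (δ : M.Dart) (hf : IsRational Γ f) (hd : ∀ P, HasOrderAt Γ f P (d P))
    (h0 : ∀ x ∉ M.V, 0 ≤ d x) : ConvexOn ℝ (Icc 0 δ.length) fun t => f (δ.arc t) := by
  refine convexOn_of_hasSlopeAlong (hf.1.comp_continuousOn (continuousOn_of_dist_eq δ.isom))
    fun t ht => ?_
  obtain ⟨s, hs⟩ := δ.exists_hasSlopeAlong hf ⟨ht.1.le, ht.2⟩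
  obtain ⟨s', hs'⟩ := δ.exists_hasSlopeAlong_sub hf ⟨ht.1, ht.2.le⟩
  refine ⟨s, s', ?_, hs, hs'⟩
  rw [← δ.eq_add_of_hasOrderAt ht (hd _) hs hs']
  exact h0 _ (δ.interior t ht)

theorem exists_slopes (hf : IsRational Γ f) (hd : ∀ P, HasOrderAt Γ f P (d P))
    (h0 : ∀ x ∉ M.V, 0 ≤ d x) :
    ∃ m : M.Dart → ℤ, (∀ δ, m δ ≤ δ.slope f) ∧ ∀ v ∈ M.V, d v = M.sumAt m v := by
  choose m hm using fun δ : M.Dart => δ.exists_hasSlopeAlong hf ⟨le_rfl, δ.length_pos⟩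
  refine ⟨m, fun δ => ?_, fun v hv => ?_⟩
  · have := (δ.convexOn hf hd h0).le_of_hasSlopeAlong ⟨le_rfl, δ.length_pos⟩ (hm δ)
      ⟨δ.length_pos.le, le_rfl⟩
    simp only [Dart.arc_length, Dart.arc_zero, sub_zero] at this
    rw [Dart.slope, le_div_iff₀ δ.length_pos]
    linarith
  · classical
    rw [sumAt_eq]
    refine (hd v).eq_sum (isStar_vertex hv).isDirections fun δ => ?_
    simpa only [zero_add] using hm δ.1

theorem Dart.le_hat (δ : M.Dart) (hf : IsRational Γ f) (hd : ∀ P, HasOrderAt Γ f P (d P))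
    (h0 : ∀ x ∉ M.V, 0 ≤ d x) {t : ℝ} (ht : t ∈ Icc 0 δ.length) :
    f (δ.arc t) ≤ δ.hat f t := by
  rcases ht.2.lt_or_eq with htl | rfl
  · obtain ⟨i, hi⟩ := δ.exists_hasSlopeAlong hf ⟨ht.1, htl⟩
    have hc := δ.convexOn hf hd h0
    have h1 := hc.le_of_hasSlopeAlong ⟨ht.1, htl⟩ hi ⟨le_rfl, δ.length_pos.le⟩
    have h2 := hc.le_of_hasSlopeAlong ⟨ht.1, htl⟩ hi ⟨δ.length_pos.le, le_rfl⟩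
    simp only [Dart.arc_length, Dart.arc_zero] at h1 h2
    rcases le_or_gt i ⌊δ.slope f⌋ with h | h
    · have : (i : ℝ) ≤ ⌊δ.slope f⌋ := by exact_mod_cast h
      exact le_max_of_le_left (by nlinarith [ht.1])
    · have : -⌊-δ.slope f⌋ ≤ i := by
        rw [Int.floor_neg, neg_neg]
        exact (Int.ceil_le_floor_add_one _).trans h
      have : -(⌊-δ.slope f⌋ : ℝ) ≤ i := by exact_mod_cast this
      exact le_max_of_le_right (by nlinarith [ht.2])
  · rw [Dart.arc_length, Dart.hat_length]

end Rational

theorem Dart.arc_inj (δ : M.Dart) {s t : ℝ} (hs : s ∈ Icc 0 δ.length) (ht : t ∈ Icc 0 δ.length)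
    (h : δ.arc s = δ.arc t) : s = t := by
  have := δ.isom s hs t ht
  rwa [h, dist_self, eq_comm, abs_eq_zero, sub_eq_zero] at this

theorem exists_eq_hat (φ : Γ → ℝ) : ∃ f : Γ → ℝ, (∀ v ∈ M.V, f v = φ v) ∧
    ∀ δ : M.Dart, ∀ t ∈ Icc 0 δ.length, f (δ.arc t) = δ.hat φ t := by
  classical
  choose D T hT hDT using M.exists_dart
  refine ⟨fun x => if h : x ∈ M.V then φ x else (D x h).hat φ (T x h), fun v hv => dif_pos hv,
    fun δ t ht => ?_⟩
  by_cases hV : δ.arc t ∈ M.V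
  · simp only [dif_pos hV]
    rcases δ.eq_or_eq_of_mem ht hV with rfl | rfl
    · rw [δ.hat_zero, δ.arc_zero]
    · rw [δ.hat_length, δ.arc_length]
  · simp only [dif_neg hV]
    have ht' : t ∈ Ioo 0 δ.length := by
      refine ⟨lt_of_le_of_ne ht.1 ?_, lt_of_le_of_ne ht.2 ?_⟩
      · rintro rfl; exact hV δ.base_mem
      · rintro rfl; exact hV (δ.arc_length ▸ δ.tip_mem)
    have h1 := hT _ hV
    have h2 := hDT _ hV
    rcases Dart.eq_of_fst (Dart.inj δ _ ht' h1 h2.symm) with h | h <;> rw [h] at h1 h2 ⊢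
    · rw [δ.arc_inj ⟨h1.1.le, h1.2.le⟩ ht h2]
    · rw [Dart.opp_arc] at h2
      rw [Dart.length_opp] at h1
      rw [Dart.hat_opp, δ.arc_inj ⟨by linarith [h1.2], by linarith [h1.1]⟩ ht h2]

theorem exists_rational_eq_hat (hΓ : IsMetricGraph Γ) (φ : Γ → ℝ) :
    ∃ f : Γ → ℝ, IsRational Γ f ∧ ∃ d : Divisor Γ, (∀ P, HasOrderAt Γ f P (d P)) ∧
      (∀ x ∉ M.V, 0 ≤ d x) ∧ (∀ v ∈ M.V, d v = M.sumAt (fun δ => ⌊δ.slope φ⌋) v) ∧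
      (∀ v ∈ M.V, f v = φ v) ∧
      ∀ δ : M.Dart, ∀ t ∈ Icc 0 δ.length, f (δ.arc t) = δ.hat φ t := by
  obtain ⟨f, hV, hf⟩ := M.exists_eq_hat φ
  have hrat : IsRational Γ f := isRational_of_forall_dart fun δ t ht => by
    obtain ⟨s, s', -, hs, -⟩ := δ.exists_hat_slopes φ t
    exact ⟨s, Dart.hasSlopeAlong_of_eqOn (hf δ) ht hs⟩
  obtain ⟨d, hd⟩ := hΓ.exists_divisor hrat
  refine ⟨f, hrat, d, hd, fun x hx => ?_, fun v hv => ?_, hV, hf⟩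
  · obtain ⟨δ, t, ht, rfl⟩ := M.exists_dart x hx
    obtain ⟨s, s', hss, ⟨ε, hε, hs⟩, ⟨ε', hε', hs'⟩⟩ := δ.exists_hat_slopes φ t
    rw [δ.eq_add_of_hasOrderAt ht (hd _)
      (Dart.hasSlopeAlong_of_eqOn (hf δ) ⟨ht.1.le, ht.2⟩ ⟨ε, hε, hs⟩) (s' := s')]
    · exact hss
    · refine ⟨min ε' t, lt_min hε' ht.1, fun x hx => ?_⟩
      have h1 := hx.2.trans (min_le_left _ _)
      have h2 := hx.2.trans (min_le_right _ _)
      simp only [sub_zero] at hs' ⊢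
      rw [hf δ _ ⟨by linarith, by linarith [ht.2, hx.1]⟩, hf δ _ ⟨ht.1.le, ht.2.le⟩,
        hs' x ⟨hx.1, h1⟩]
  · classical
    rw [sumAt_eq]
    refine (hd v).eq_sum (isStar_vertex hv).isDirections
      (s := fun δ : {δ : M.Dart // δ.base = v} => ⌊δ.1.slope φ⌋) fun δ => ?_
    have := Dart.hasSlopeAlong_of_eqOn (hf δ.1) ⟨le_rfl, δ.1.length_pos⟩ (δ.1.hat_slope_zero φ)
    simpa only [zero_add] using this

end GraphModel

section DivisorBasics

variable {Γ : Type}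

theorem divDeg_eq_sum {D : Divisor Γ} {S : Finset Γ} (h : D.support ⊆ S) :
    divDeg D = ∑ v ∈ S, D v :=
  Finsupp.sum_of_support_subset D h _ fun _ _ => rfl

theorem divDeg_add (D D' : Divisor Γ) : divDeg (D + D') = divDeg D + divDeg D' :=
  Finsupp.sum_add_index' (fun _ => rfl) fun _ _ _ => rfl

theorem divDeg_sub (D D' : Divisor Γ) : divDeg (D - D') = divDeg D - divDeg D' := by
  rw [eq_sub_iff_add_eq, ← divDeg_add, sub_add_cancel]

theorem divDeg_single (P : Γ) (n : ℤ) : divDeg (Finsupp.single P n) = n :=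
  Finsupp.sum_single_index rfl

theorem Effective.divDeg_nonneg {D : Divisor Γ} (h : Effective D) : 0 ≤ divDeg D :=
  Finset.sum_nonneg fun v _ => h v

theorem Effective.add {D D' : Divisor Γ} (h : Effective D) (h' : Effective D') :
    Effective (D + D') := fun P => add_nonneg (h P) (h' P)

theorem Effective.single (P : Γ) {n : ℤ} (h : 0 ≤ n) : Effective (Finsupp.single P n) := by
  classical
  intro Q
  rw [Finsupp.single_apply]
  split_ifs <;> simp [h]

variable [MetricSpace Γ] {D D₁ D₂ D₃ D₄ : Divisor Γ}

theorem LinEquiv.refl (hΓ : IsMetricGraph Γ) (D : Divisor Γ) : LinEquiv Γ D D := by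
  have h0 : IsRational Γ 0 := ⟨continuous_zero, fun _ τ _ => ⟨0, .zero τ⟩⟩
  refine ⟨0, h0, fun P => ?_⟩
  obtain ⟨τ, r, h⟩ := hΓ.exists_isStar P
  have := h.isDirections.hasOrderAt fun i => HasSlopeAlong.zero (τ i)
  simpa using this

theorem LinEquiv.symm (h : LinEquiv Γ D₁ D₂) : LinEquiv Γ D₂ D₁ := by
  obtain ⟨f, hf, hd⟩ := h
  exact ⟨-f, hf.neg, fun P => by simpa using (hd P).neg⟩

theorem LinEquiv.add (h : LinEquiv Γ D₁ D₂) (h' : LinEquiv Γ D₃ D₄) :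
    LinEquiv Γ (D₁ + D₃) (D₂ + D₄) := by
  obtain ⟨f, hf, hd⟩ := h
  obtain ⟨f', hf', hd'⟩ := h'
  refine ⟨f + f', hf.add hf', fun P => ?_⟩
  have := (hd P).add (hd' P)
  rwa [sub_add_sub_comm] at this

theorem LinEquiv.neg (h : LinEquiv Γ D₁ D₂) : LinEquiv Γ (-D₁) (-D₂) := by
  obtain ⟨f, hf, hd⟩ := h
  refine ⟨-f, hf.neg, fun P => ?_⟩
  have := (hd P).neg
  rwa [neg_sub, ← neg_sub_neg] at this

theorem LinEquiv.sub (h : LinEquiv Γ D₁ D₂) (h' : LinEquiv Γ D₃ D₄) :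
    LinEquiv Γ (D₁ - D₃) (D₂ - D₄) := by
  rw [sub_eq_add_neg, sub_eq_add_neg]
  exact h.add h'.neg

theorem LinEquiv.divDeg_le (hΓ : IsMetricGraph Γ) (h : LinEquiv Γ D₁ D₂) :
    divDeg D₂ ≤ divDeg D₁ := by
  obtain ⟨f, hf, hd⟩ := h
  obtain ⟨M, hM⟩ := hΓ.exists_model (D₂ - D₁).support
  obtain ⟨m, hm, hv⟩ := M.exists_slopes hf hd fun x hx => by
    have := Finsupp.notMem_support_iff.1 fun h => hx (hM h)
    exact this.ge
  rw [← sub_nonpos, ← divDeg_sub, divDeg_eq_sum hM]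
  calc ∑ v ∈ M.V, (D₂ - D₁) v = ∑ v ∈ M.V, M.sumAt m v := Finset.sum_congr rfl hv
    _ = ∑ δ, m δ := GraphModel.sum_sumAt m
    _ ≤ 0 := GraphModel.sum_nonpos_of_le_slope hm

theorem LinEquiv.divDeg_eq (hΓ : IsMetricGraph Γ) (h : LinEquiv Γ D₁ D₂) :
    divDeg D₁ = divDeg D₂ :=
  le_antisymm (h.symm.divDeg_le hΓ) (h.divDeg_le hΓ)

end DivisorBasics

namespace GraphModel

variable {Γ : Type} [MetricSpace Γ] {M : GraphModel Γ}

theorem nonempty_V [Nonempty Γ] : M.V.Nonempty := by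
  obtain ⟨x⟩ := ‹Nonempty Γ›
  by_cases hx : x ∈ M.V
  · exact ⟨x, hx⟩
  · obtain ⟨δ, -⟩ := M.exists_dart x hx
    exact ⟨_, δ.base_mem⟩

variable (M) in
/-- The divisor of the acyclic orientation of the edges in the direction of growing `π`:
the number of outgoing edges minus one at each vertex. -/
noncomputable def orient (π : Γ → ℤ) : Divisor Γ :=
  open Classical in Finsupp.onFinset M.V (fun v => if v ∈ M.V then
    M.sumAt (fun δ => if π δ.base < π δ.tip then (1 : ℤ) else 0) v - 1 else 0)
    fun _ hv => by_contra fun h => hv (if_neg h)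

theorem orient_apply (π : Γ → ℤ) {v : Γ} (hv : v ∈ M.V) :
    M.orient π v = M.sumAt (fun δ => if π δ.base < π δ.tip then (1 : ℤ) else 0) v - 1 :=
  if_pos hv

theorem orient_apply_of_notMem (π : Γ → ℤ) {v : Γ} (hv : v ∉ M.V) : M.orient π v = 0 :=
  if_neg hv

theorem support_orient_subset (π : Γ → ℤ) : (M.orient π).support ⊆ M.V :=
  Finsupp.support_onFinset_subset

theorem not_equivEffective_orient [Nonempty Γ] (π : Γ → ℤ) :
    ¬ EquivEffective Γ (M.orient π) := by
  classical
  rintro ⟨D', hD', f, hf, hd⟩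
  obtain ⟨m, hm, hv⟩ := M.exists_slopes hf hd fun x hx => by
    rw [orient_apply_of_notMem π hx, sub_zero]
    exact hD' x
  obtain ⟨w, hw, hwmax⟩ := M.V.exists_max_image f M.nonempty_V
  obtain ⟨v, hvm, hvmax⟩ := (M.V.filter fun x => f x = f w).exists_max_image π
    ⟨w, Finset.mem_filter.2 ⟨hw, rfl⟩⟩
  rw [Finset.mem_filter] at hvm
  have h1 : M.sumAt m v ≤ M.sumAt (fun δ => -(if π δ.base < π δ.tip then (1 : ℤ) else 0)) v := by
    refine Finset.sum_le_sum fun δ hδ => ?_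
    obtain rfl : δ.base = v := (Finset.mem_filter.1 hδ).2
    have hle : f δ.tip ≤ f δ.base := hvm.2 ▸ hwmax _ δ.tip_mem
    have hmul := δ.slope_mul_length f
    have hℓ := δ.length_pos
    split_ifs with hup
    · have hlt : f δ.tip < f δ.base := by
        refine lt_of_le_of_ne hle fun he => ?_
        have := hvmax δ.tip (Finset.mem_filter.2 ⟨δ.tip_mem, he.trans hvm.2⟩)
        omega
      have : δ.slope f < 0 := by nlinarith
      have : (m δ : ℝ) < 0 := (hm δ).trans_lt this
      have : m δ < 0 := by exact_mod_cast this
      omega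
    · have : δ.slope f ≤ 0 := by nlinarith
      have : (m δ : ℝ) ≤ 0 := (hm δ).trans this
      simpa using this
  have h2 := hv v hvm.1
  have h3 := hD' v
  rw [orient_apply π hvm.1] at h2
  simp only [sumAt, Finset.sum_neg_distrib] at h1 h2
  omega

theorem sumAt_add (m m' : M.Dart → ℤ) (v : Γ) :
    M.sumAt (fun δ => m δ + m' δ) v = M.sumAt m v + M.sumAt m' v :=
  Finset.sum_add_distrib

theorem valence_eq_sumAt (hΓ : IsMetricGraph Γ) {v : Γ} (hv : v ∈ M.V) :
    (valence Γ v : ℤ) = M.sumAt (fun _ => (1 : ℤ)) v := by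
  classical
  rw [hΓ.valence_eq_card (isStar_vertex hv).isDirections, sumAt_eq]
  simp

theorem orient_add_orient_neg (hΓ : IsMetricGraph Γ) {K : Divisor Γ} (hK : IsCanonical Γ K)
    (hKV : K.support ⊆ M.V) {π : Γ → ℤ} (hπ : ∀ δ : M.Dart, π δ.base ≠ π δ.tip) :
    M.orient π + M.orient (-π) = K := by
  ext v
  rw [Finsupp.add_apply]
  by_cases hv : v ∈ M.V
  · have : ∀ δ : M.Dart, (1 : ℤ) = (if π δ.base < π δ.tip then (1 : ℤ) else 0) +
        (if (-π) δ.base < (-π) δ.tip then (1 : ℤ) else 0) := by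
      intro δ
      have := hπ δ
      simp only [Pi.neg_apply]
      split_ifs <;> omega
    rw [hK v, valence_eq_sumAt hΓ hv, orient_apply π hv, orient_apply (-π) hv, funext this,
      sumAt_add]
    ring
  · rw [orient_apply_of_notMem π hv, orient_apply_of_notMem (-π) hv, add_zero]
    exact (Finsupp.notMem_support_iff.1 fun h => hv (hKV h)).symm

theorem divDeg_orient_neg (π : Γ → ℤ) : divDeg (M.orient (-π)) = divDeg (M.orient π) := by
  have key : ∀ π : Γ → ℤ, divDeg (M.orient π) =
      ∑ δ : M.Dart, (if π δ.base < π δ.tip then (1 : ℤ) else 0) - M.V.card := by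
    intro π
    rw [divDeg_eq_sum (support_orient_subset π),
      Finset.sum_congr rfl fun v hv => orient_apply π hv, Finset.sum_sub_distrib, sum_sumAt]
    simp
  rw [key, key, ← Dart.sum_opp]
  simp

variable (M) in
/-- The sum of the rounded down slopes of `φ` on the edges emanating from `v`. -/
noncomputable def floorLaplacian (φ : Γ → ℝ) (v : Γ) : ℤ :=
  M.sumAt (fun δ => ⌊δ.slope φ⌋) v

theorem sumAt_le_sumAt {m m' : M.Dart → ℤ} {v : Γ} (h : ∀ δ : M.Dart, δ.base = v → m δ ≤ m' δ) :
    M.sumAt m v ≤ M.sumAt m' v := by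
  classical
  exact Finset.sum_le_sum fun δ hδ => h δ (Finset.mem_filter.1 hδ).2

theorem sumAt_nonneg {m : M.Dart → ℤ} {v : Γ} (h : ∀ δ : M.Dart, δ.base = v → 0 ≤ m δ) :
    0 ≤ M.sumAt m v := by
  classical
  exact Finset.sum_nonneg fun δ hδ => h δ (Finset.mem_filter.1 hδ).2

theorem Dart.le_sumAt {m : M.Dart → ℤ} (δ : M.Dart)
    (h : ∀ δ' : M.Dart, δ'.base = δ.base → 0 ≤ m δ') : m δ ≤ M.sumAt m δ.base := by
  classical
  exact Finset.single_le_sum (f := m) (fun δ' hδ' => h δ' (Finset.mem_filter.1 hδ').2)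
    (Finset.mem_filter.2 ⟨Finset.mem_univ δ, rfl⟩)

theorem Dart.slope_add (δ : M.Dart) (φ ψ : Γ → ℝ) :
    δ.slope (φ + ψ) = δ.slope φ + δ.slope ψ := by
  simp only [Dart.slope, Pi.add_apply]
  ring

theorem floorLaplacian_add_le (φ ψ : Γ → ℝ) (v : Γ) :
    M.floorLaplacian φ v + M.floorLaplacian ψ v ≤ M.floorLaplacian (φ + ψ) v := by
  rw [floorLaplacian, floorLaplacian, ← sumAt_add]
  refine sumAt_le_sumAt fun δ _ => ?_
  rw [Dart.slope_add]
  exact Int.le_floor_add _ _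

theorem floorLaplacian_zero (v : Γ) : M.floorLaplacian 0 v = 0 := by
  simp [floorLaplacian, Dart.slope, sumAt]

section Existence

variable [ConnectedSpace Γ] {P₀ : Γ}

theorem exists_le_floorLaplacian (hP₀ : P₀ ∈ M.V) : ∀ w ∈ M.V, ∀ N : ℕ, ∃ φ : Γ → ℝ,
    (∀ u, u ≠ P₀ → 0 ≤ M.floorLaplacian φ u) ∧ (w ≠ P₀ → N ≤ M.floorLaplacian φ w) := by
  classical
  refine forall_of_step hP₀ (fun N => ⟨0, fun u _ => (floorLaplacian_zero u).ge, fun h =>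
    absurd rfl h⟩) fun δ₀ ih N => ?_
  obtain ⟨L, hL⟩ : ∃ L, ∀ δ : M.Dart, δ.length ≤ L := by
    obtain ⟨L, hL⟩ := Set.finite_range (fun δ : M.Dart => δ.length) |>.bddAbove
    exact ⟨L, fun δ => hL ⟨δ, rfl⟩⟩
  set w := δ₀.base with hw
  let ψ : Γ → ℝ := fun x => if x = w then N * L else 0
  have hN : (0 : ℝ) ≤ N := N.cast_nonneg
  have hslope : ∀ δ : M.Dart, δ.base ≠ w →
      0 ≤ ⌊δ.slope ψ⌋ ∧ (δ.tip = w → (N : ℤ) ≤ ⌊δ.slope ψ⌋) := by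
    intro δ hδ
    have hLpos : 0 ≤ L := δ.length_pos.le.trans (hL δ)
    refine ⟨Int.floor_nonneg.2 ?_, fun ht => Int.le_floor.2 ?_⟩
    · simp only [Dart.slope, ψ, if_neg hδ, sub_zero]
      have := δ.length_pos
      split_ifs <;> positivity
    · simp only [Dart.slope, ψ, if_neg hδ, if_pos ht, sub_zero]
      rw [le_div_iff₀ δ.length_pos, Int.cast_natCast]
      exact mul_le_mul_of_nonneg_left (hL δ) hN
  have hψ : ∀ u, u ≠ w → 0 ≤ M.floorLaplacian ψ u := fun u hu =>
    sumAt_nonneg fun δ hδ => (hslope δ (hδ ▸ hu)).1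
  have hψt : N ≤ M.floorLaplacian ψ δ₀.tip := by
    have h1 : δ₀.opp.base ≠ w := δ₀.base_ne_tip.symm
    exact ((hslope δ₀.opp h1).2 (by simp [hw])).trans
      (δ₀.opp.le_sumAt (m := fun δ => ⌊δ.slope ψ⌋) fun δ' hδ' => (hslope δ' (hδ' ▸ h1)).1)
  obtain ⟨χ, hχ, hχw⟩ := ih (-M.floorLaplacian ψ w).toNat
  refine ⟨ψ + χ, fun u hu => ?_, fun ht => ?_⟩
  · refine le_trans ?_ (floorLaplacian_add_le ψ χ u)
    by_cases huw : u = w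
    · subst huw
      have := hχw hu
      have := Int.self_le_toNat (-M.floorLaplacian ψ δ₀.base)
      omega
    · exact add_nonneg (hψ u huw) (hχ u hu)
  · have := floorLaplacian_add_le (M := M) ψ χ δ₀.tip
    have := hχ _ ht
    omega

theorem exists_forall_le_floorLaplacian (hP₀ : P₀ ∈ M.V) (N : ℕ) :
    ∃ φ : Γ → ℝ, ∀ u ∈ M.V, u ≠ P₀ → N ≤ M.floorLaplacian φ u := by
  classical
  have key : ∀ S : Finset Γ, S ⊆ M.V → ∃ φ : Γ → ℝ, (∀ u, u ≠ P₀ → 0 ≤ M.floorLaplacian φ u) ∧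
      ∀ u ∈ S, u ≠ P₀ → N ≤ M.floorLaplacian φ u := by
    intro S
    induction S using Finset.induction_on with
    | empty => exact fun _ => ⟨0, fun u _ => (floorLaplacian_zero u).ge, by simp⟩
    | insert w S _ ih =>
      intro hS
      obtain ⟨φ, h1, h2⟩ := ih fun x hx => hS (Finset.mem_insert_of_mem hx)
      obtain ⟨ψ, h3, h4⟩ := exists_le_floorLaplacian hP₀ w (hS (Finset.mem_insert_self _ _)) N
      refine ⟨φ + ψ, fun u hu => (add_nonneg (h1 u hu) (h3 u hu)).trans
        (floorLaplacian_add_le φ ψ u), fun u hu hne => ?_⟩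
      have := floorLaplacian_add_le (M := M) φ ψ u
      have := h1 u hne
      have := h3 u hne
      rcases Finset.mem_insert.1 hu with rfl | hu
      · have := h4 hne
        omega
      · have := h2 u hu hne
        omega
  obtain ⟨φ, -, h⟩ := key M.V Finset.Subset.rfl
  exact ⟨φ, h⟩

end Existence

theorem upperSemicontinuous_floorLaplacian (v : Γ) :
    UpperSemicontinuous fun φ : Γ → ℝ => M.floorLaplacian φ v := by
  refine upperSemicontinuous_sum fun δ _ => ?_
  have h1 : UpperSemicontinuous (fun x : ℝ => ⌊x⌋) := by
    refine upperSemicontinuous_iff_isClosed_preimage.2 fun y => ?_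
    convert isClosed_Ici (a := (y : ℝ)) using 1
    ext x
    exact Int.le_floor
  refine h1.comp (g := fun φ : Γ → ℝ => δ.slope φ) ?_
  unfold Dart.slope
  fun_prop

theorem Dart.slope_le (δ : M.Dart) {D : Γ → ℤ} {φ : Γ → ℝ}
    (h : ∀ v ∈ M.V, 0 ≤ D v + M.floorLaplacian φ v) :
    δ.slope φ ≤ 2 * ∑ v ∈ M.V, |(D v : ℝ)| := by
  classical
  rcases le_or_gt (δ.slope φ) 0 with h0 | h0
  · exact h0.trans (by positivity)
  have hsign : ∀ δ : M.Dart, 0 < δ.slope φ ↔ φ δ.base < φ δ.tip := by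
    intro δ
    rw [Dart.slope, div_pos_iff_of_pos_right δ.length_pos, sub_pos]
  let χ : Γ → ℝ := fun x => if φ δ.tip ≤ φ x then 1 else 0
  have hχ0 : ∀ x, 0 ≤ χ x := fun x => by simp only [χ]; split_ifs <;> norm_num
  have hχ1 : ∀ x, χ x ≤ 1 := fun x => by simp only [χ]; split_ifs <;> norm_num
  have hχm : ∀ x y, φ x ≤ φ y → χ x ≤ χ y := fun x y hxy => by
    simp only [χ]
    split_ifs with h1 h2 h2 <;> first | exact absurd (h1.trans hxy) h2 | norm_num
  have h1 : -∑ v ∈ M.V, |(D v : ℝ)| ≤ ∑ δ : M.Dart, χ δ.base * δ.slope φ := by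
    have hfib : ∑ δ : M.Dart, χ δ.base * δ.slope φ =
        ∑ v ∈ M.V, M.sumAt (fun δ => χ δ.base * δ.slope φ) v := (sum_sumAt _).symm
    rw [hfib, ← Finset.sum_neg_distrib]
    refine Finset.sum_le_sum fun v hv => ?_
    have hle : (M.floorLaplacian φ v : ℝ) ≤ M.sumAt (fun δ => δ.slope φ) v := by
      simp only [floorLaplacian, sumAt, Int.cast_sum]
      exact Finset.sum_le_sum fun δ _ => Int.floor_le _
    have hval : M.sumAt (fun δ => χ δ.base * δ.slope φ) v =
        χ v * M.sumAt (fun δ => δ.slope φ) v := by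
      rw [sumAt, sumAt, Finset.mul_sum]
      exact Finset.sum_congr rfl fun δ hδ => by rw [(Finset.mem_filter.1 hδ).2]
    have hv' : (0 : ℝ) ≤ D v + M.floorLaplacian φ v := by exact_mod_cast h v hv
    rw [hval]
    have habs := le_abs_self (D v : ℝ)
    nlinarith [hχ0 v, hχ1 v, abs_nonneg (D v : ℝ)]
  have h2 : 2 * ∑ δ : M.Dart, χ δ.base * δ.slope φ =
      -∑ δ : M.Dart, (χ δ.tip - χ δ.base) * δ.slope φ := by
    have := Dart.sum_opp fun δ : M.Dart => χ δ.base * δ.slope φ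
    simp only [Dart.base_opp, Dart.slope_opp, mul_neg, Finset.sum_neg_distrib] at this
    simp only [sub_mul, Finset.sum_sub_distrib]
    linarith
  have h3 : (χ δ.tip - χ δ.base) * δ.slope φ ≤
      ∑ δ : M.Dart, (χ δ.tip - χ δ.base) * δ.slope φ := by
    refine Finset.single_le_sum (f := fun δ : M.Dart => (χ δ.tip - χ δ.base) * δ.slope φ)
      (fun δ _ => ?_) (Finset.mem_univ δ)
    rcases le_or_gt (δ.slope φ) 0 with hs | hs
    · refine mul_nonneg_of_nonpos_of_nonpos (sub_nonpos.2 (hχm _ _ ?_)) hs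
      by_contra! hlt
      exact absurd ((hsign δ).2 hlt) (not_lt.2 hs)
    · exact mul_nonneg (sub_nonneg.2 (hχm _ _ ((hsign δ).1 hs).le)) hs.le
  have h4 : χ δ.tip - χ δ.base = 1 := by
    simp only [χ, le_refl, if_true, if_neg (not_le.2 ((hsign δ).1 h0)), sub_zero]
  rw [h4, one_mul] at h3
  linarith

theorem exists_max [ConnectedSpace Γ] {P₀ : Γ} (hP₀ : P₀ ∈ M.V) {D : Γ → ℤ} {φ₀ : Γ → ℝ}
    (h₀ : ∀ v ∈ M.V, 0 ≤ D v + M.floorLaplacian φ₀ v) :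
    ∃ φ : Γ → ℝ, (∀ v ∈ M.V, 0 ≤ D v + M.floorLaplacian φ v) ∧
      ∀ ψ : Γ → ℝ, (∀ v ∈ M.V, 0 ≤ D v + M.floorLaplacian ψ v) → ψ P₀ = φ P₀ →
        (∀ v ∈ M.V, φ v ≤ ψ v) → ∀ v ∈ M.V, ψ v = φ v := by
  classical
  let X : Set (Γ → ℝ) := {φ | (∀ v ∈ M.V, 0 ≤ D v + M.floorLaplacian φ v) ∧ φ P₀ = 0 ∧
    ∀ x ∉ M.V, φ x = 0}
  let norm : (Γ → ℝ) → Γ → ℝ := fun φ x => if x ∈ M.V then φ x - φ P₀ else 0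
  have hnorm : ∀ φ : Γ → ℝ, (∀ v ∈ M.V, 0 ≤ D v + M.floorLaplacian φ v) → norm φ ∈ X := by
    intro φ hφ
    refine ⟨fun v hv => ?_, by simp [norm, hP₀], fun x hx => if_neg hx⟩
    have : ∀ δ : M.Dart, δ.slope (norm φ) = δ.slope φ := fun δ => by
      simp only [Dart.slope, norm, if_pos δ.tip_mem, if_pos δ.base_mem, sub_sub_sub_cancel_right]
    simpa only [floorLaplacian, this] using hφ v hv
  have hclosed : IsClosed X := by
    have : X = (⋂ v ∈ M.V, (fun φ : Γ → ℝ => M.floorLaplacian φ v) ⁻¹' Ici (-D v)) ∩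
        ({φ | φ P₀ = 0} ∩ ⋂ x ∈ (M.V : Set Γ)ᶜ, {φ : Γ → ℝ | φ x = 0}) := by
      ext φ
      simp [X, neg_le_iff_add_nonneg']
    rw [this]
    refine (isClosed_biInter fun v _ =>
      (upperSemicontinuous_floorLaplacian v).isClosed_preimage _).inter
      ((isClosed_eq (by fun_prop) continuous_const).inter (isClosed_biInter fun x _ =>
        isClosed_eq (by fun_prop) continuous_const))
  have hbound : ∀ v ∈ M.V, ∃ R : ℝ, ∀ φ ∈ X, |φ v| ≤ R := by
    refine forall_of_step hP₀ ⟨0, fun φ hφ => by simp [hφ.2.1]⟩ ?_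
    rintro δ ⟨R, hR⟩
    refine ⟨R + 2 * (∑ v ∈ M.V, |(D v : ℝ)|) * δ.length, fun φ hφ => ?_⟩
    have h1 := δ.slope_le hφ.1
    have h2 := δ.opp.slope_le hφ.1
    rw [Dart.slope_opp] at h2
    have h3 := δ.slope_mul_length φ
    have h4 := abs_le.1 (hR φ hφ)
    have hℓ := δ.length_pos
    rw [abs_le]
    constructor <;> nlinarith
  have hbound' : ∀ x, ∃ R : ℝ, ∀ φ ∈ X, |φ x| ≤ R := by
    intro x
    by_cases hx : x ∈ M.V
    · exact hbound x hx
    · exact ⟨0, fun φ hφ => by simp [hφ.2.2 x hx]⟩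
  choose R hR using hbound'
  have hcompact : IsCompact X :=
    (isCompact_univ_pi fun x => isCompact_Icc (a := -R x) (b := R x)).of_isClosed_subset hclosed
      fun φ hφ x _ => abs_le.1 (hR x φ hφ)
  obtain ⟨φ, hφ, hmax⟩ := hcompact.exists_isMaxOn ⟨_, hnorm φ₀ h₀⟩
    (f := fun φ : Γ → ℝ => ∑ v ∈ M.V, φ v) (by fun_prop)
  refine ⟨φ, hφ.1, fun ψ hψ h1 h2 => ?_⟩
  have h3 : ∑ v ∈ M.V, norm ψ v ≤ ∑ v ∈ M.V, φ v := hmax (hnorm ψ hψ)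
  have h4 : ∑ v ∈ M.V, norm ψ v = ∑ v ∈ M.V, ψ v :=
    Finset.sum_congr rfl fun v hv => by simp [norm, hv, h1, hφ.2.1]
  rw [h4] at h3
  have h5 := (Finset.sum_eq_sum_iff_of_le h2).1 (le_antisymm (Finset.sum_le_sum h2) h3)
  exact fun v hv => (h5 v hv).symm

/-- Dhar's burning algorithm. -/
theorem exists_le_orient {F : Γ → ℤ} (h : ∀ B : Finset Γ, B ⊆ M.V → B.Nonempty →
    ∃ v ∈ B, F v < M.sumAt (fun δ => open Classical in if δ.tip ∈ B then (0 : ℤ) else 1) v) :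
    ∃ π : Γ → ℤ, (∀ δ : M.Dart, π δ.base ≠ π δ.tip) ∧ ∀ v ∈ M.V, F v ≤ M.orient π v := by
  classical
  have key : ∀ n : ℕ, ∀ B : Finset Γ, B.card = n → B ⊆ M.V → ∃ π : Γ → ℤ, InjOn π B ∧
      ∀ v ∈ B, F v < M.sumAt (fun δ =>
        if δ.tip ∉ B ∨ π δ.base < π δ.tip then (1 : ℤ) else 0) v := by
    intro n
    induction n with
    | zero =>
      intro B hB _
      obtain rfl := Finset.card_eq_zero.1 hB
      exact ⟨0, by simp, by simp⟩
    | succ n ih =>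
      intro B hB hBV
      obtain ⟨v, hv, hFv⟩ := h B hBV (Finset.card_pos.1 (by omega))
      obtain ⟨π, hπ, hF⟩ := ih (B.erase v) (by rw [Finset.card_erase_of_mem hv, hB]; rfl)
        ((Finset.erase_subset _ _).trans hBV)
      have hlt : ∀ u ∈ B.erase v, π u < 1 + ∑ u ∈ B.erase v, |π u| := fun u hu => by
        have := Finset.single_le_sum (f := fun u => |π u|) (fun u _ => abs_nonneg _) hu
        have := le_abs_self (π u)
        linarith
      refine ⟨Function.update π v (1 + ∑ u ∈ B.erase v, |π u|), ?_, fun u hu => ?_⟩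
      · intro x hx y hy hxy
        by_cases hxv : x = v <;> by_cases hyv : y = v
        · rw [hxv, hyv]
        · rw [hxv, Function.update_self, Function.update_of_ne hyv] at hxy
          exact absurd hxy (hlt y (Finset.mem_erase.2 ⟨hyv, hy⟩)).ne'
        · rw [hyv, Function.update_self, Function.update_of_ne hxv] at hxy
          exact absurd hxy (hlt x (Finset.mem_erase.2 ⟨hxv, hx⟩)).ne
        · rw [Function.update_of_ne hxv, Function.update_of_ne hyv] at hxy
          exact hπ (Finset.mem_erase.2 ⟨hxv, hx⟩) (Finset.mem_erase.2 ⟨hyv, hy⟩) hxy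
      · by_cases huv : u = v
        · rw [huv]
          refine hFv.trans_le (sumAt_le_sumAt fun δ _ => ?_)
          split_ifs <;> simp_all
        · have hu' : u ∈ B.erase v := Finset.mem_erase.2 ⟨huv, hu⟩
          refine (hF u hu').trans_le (sumAt_le_sumAt fun δ hδ => ?_)
          by_cases ht : δ.tip = v
          · have : Function.update π v (1 + ∑ u ∈ B.erase v, |π u|) δ.base <
                Function.update π v (1 + ∑ u ∈ B.erase v, |π u|) δ.tip := by
              rw [ht, Function.update_self, hδ, Function.update_of_ne huv]
              exact hlt u hu'
            rw [if_pos (Or.inr this)]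
            split_ifs <;> norm_num
          · simp [hδ, Function.update_of_ne huv, ht]
  obtain ⟨π, hπ, hF⟩ := key _ M.V rfl Finset.Subset.rfl
  refine ⟨π, fun δ he => δ.base_ne_tip (hπ δ.base_mem δ.tip_mem he), fun v hv => ?_⟩
  rw [orient_apply π hv, Int.le_sub_one_iff]
  simpa only [Dart.tip_mem, not_true, false_or] using hF v hv

theorem Dart.hat_nonneg (δ : M.Dart) {φ : Γ → ℝ} (h : ∀ x, 0 ≤ φ x) {t : ℝ}
    (ht : t ∈ Icc 0 δ.length) : 0 ≤ δ.hat φ t := by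
  rcases le_total 0 (δ.slope φ) with hs | hs
  · refine le_max_of_le_left (add_nonneg (h _) (mul_nonneg ?_ ht.1))
    exact_mod_cast Int.floor_nonneg.2 hs
  · refine le_max_of_le_right (add_nonneg (h _) (mul_nonneg ?_ (sub_nonneg.2 ht.2)))
    exact_mod_cast Int.floor_nonneg.2 (neg_nonneg.2 hs)

/-- A rational function which is positive exactly around `B` and whose slopes at `B` are at least
`-1`. -/
theorem exists_bump (hΓ : IsMetricGraph Γ) (B : Finset Γ) (hB : B ⊆ M.V) :
    ∃ g : Γ → ℝ, IsRational Γ g ∧ (∀ x, 0 ≤ g x) ∧ (∀ v ∈ B, 0 < g v) ∧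
      (∀ v ∈ M.V, v ∉ B → g v = 0) ∧ ∃ d : Divisor Γ, (∀ P, HasOrderAt Γ g P (d P)) ∧
        (∀ x, x ∉ B → 0 ≤ d x) ∧ ∀ v ∈ B,
          -M.sumAt (fun δ => open Classical in if δ.tip ∈ B then (0 : ℤ) else 1) v ≤ d v := by
  classical
  obtain ⟨ε, hε, hεℓ⟩ := exists_pos_forall_lt fun δ : M.Dart => δ.length_pos
  let φ : Γ → ℝ := fun x => if x ∈ B then ε else 0
  have hφ0 : ∀ x, 0 ≤ φ x := fun x => by simp only [φ]; split_ifs <;> simp [hε.le]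
  obtain ⟨g, hg, d, hd, hd0, hdV, hgV, hgE⟩ := M.exists_rational_eq_hat hΓ φ
  refine ⟨g, hg, fun x => ?_, fun v hv => ?_, fun v hv hvB => ?_, d, hd, fun x hx => ?_,
    fun v hv => ?_⟩
  · by_cases hx : x ∈ M.V
    · rw [hgV x hx]
      exact hφ0 x
    · obtain ⟨δ, t, ht, rfl⟩ := M.exists_dart x hx
      rw [hgE δ t ⟨ht.1.le, ht.2.le⟩]
      exact δ.hat_nonneg hφ0 ⟨ht.1.le, ht.2.le⟩
  · rw [hgV v (hB hv)]
    simpa [φ, hv] using hε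
  · rw [hgV v hv]
    simp [φ, hvB]
  · by_cases hxV : x ∈ M.V
    · rw [hdV x hxV]
      refine sumAt_nonneg fun δ hδ => Int.floor_nonneg.2 (div_nonneg ?_ δ.length_pos.le)
      rw [hδ]
      simpa [φ, hx] using hφ0 δ.tip
    · exact hd0 x hxV
  · rw [hdV v (hB hv), sumAt, ← Finset.sum_neg_distrib]
    refine sumAt_le_sumAt (m := fun δ => -if δ.tip ∈ B then (0 : ℤ) else 1) fun δ hδ => ?_
    rw [Int.le_floor, Dart.slope, le_div_iff₀ δ.length_pos]
    have := hεℓ δ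
    have := δ.length_pos
    split_ifs with ht
    · simp [φ, hδ, hv, ht]
    · simp only [φ, hδ, if_pos hv, if_neg ht]
      push_cast
      linarith

end GraphModel

open GraphModel in
theorem exists_orient_sub_effective {Γ : Type} [MetricSpace Γ] (hΓ : IsMetricGraph Γ)
    {F : Divisor Γ} (hF : ¬ EquivEffective Γ F) (S : Finset Γ) :
    ∃ M : GraphModel Γ, S ⊆ M.V ∧ ∃ π : Γ → ℤ, (∀ δ : M.Dart, π δ.base ≠ π δ.tip) ∧
      ∃ F' : Divisor Γ, LinEquiv Γ F F' ∧ Effective (M.orient π - F') := by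
  classical
  have := hΓ.2.1
  obtain ⟨P₀⟩ : Nonempty Γ := inferInstance
  obtain ⟨M, hM⟩ := hΓ.exists_model (insert P₀ F.support)
  have hP₀ : P₀ ∈ M.V := hM (Finset.mem_insert_self _ _)
  have hFV : ∀ x ∉ M.V, F x = 0 := fun x hx =>
    Finsupp.notMem_support_iff.1 fun h => hx (hM (Finset.mem_insert_of_mem h))
  obtain ⟨N, hN⟩ : ∃ N : ℕ, ∀ x ∈ M.V, |F x| ≤ N := by
    refine ⟨(∑ x ∈ M.V, |F x|).toNat, fun x hx => ?_⟩
    exact (Finset.single_le_sum (f := fun x => |F x|) (fun _ _ => abs_nonneg _) hx).trans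
      (Int.self_le_toNat _)
  obtain ⟨φ₀, hφ₀⟩ := exists_forall_le_floorLaplacian hP₀ N
  let D : Γ → ℤ := fun x => if x = P₀ then F P₀ + |F P₀ + M.floorLaplacian φ₀ P₀| else F x
  have hDF : ∀ x, x ≠ P₀ → D x = F x := fun x hx => if_neg hx
  obtain ⟨φ, hφ, hmax⟩ := exists_max (M := M) hP₀ (D := D) (φ₀ := φ₀) fun v hv => by
    by_cases hvP : v = P₀
    · subst hvP
      have := neg_abs_le (F v + M.floorLaplacian φ₀ v)
      simp only [D, if_true]
      linarith
    · rw [hDF v hvP]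
      have := hφ₀ v hv hvP
      have := hN v hv
      have := neg_abs_le (F v)
      linarith
  obtain ⟨h, hh, d, hd, hd0, hdV, hhV, hhE⟩ := M.exists_rational_eq_hat hΓ φ
  have hmax' : ∀ f : Γ → ℝ, IsRational Γ f → ∀ c : Γ → ℤ, (∀ P, HasOrderAt Γ f P (c P)) →
      (∀ x, 0 ≤ D x + c x) → f P₀ = h P₀ → (∀ x, h x ≤ f x) → ∀ x, f x ≤ h x := by
    intro f hf c hc hDc hfP hle x
    have hc0 : ∀ x ∉ M.V, 0 ≤ c x := fun x hx => by
      have := hDc x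
      rwa [hDF x (by rintro rfl; exact hx hP₀), hFV x hx, zero_add] at this
    obtain ⟨m, hm, hcm⟩ := M.exists_slopes hf hc hc0
    have heq : ∀ v ∈ M.V, f v = φ v := by
      refine hmax f (fun v hv => ?_) (by rw [hfP, hhV _ hP₀]) fun v hv => hhV v hv ▸ hle v
      refine (hDc v).trans (add_le_add_right ?_ _)
      rw [hcm v hv]
      exact sumAt_le_sumAt fun δ _ => Int.le_floor.2 (hm δ)
    by_cases hx : x ∈ M.V
    · rw [heq x hx, hhV x hx]
    · obtain ⟨δ, t, ht, rfl⟩ := M.exists_dart x hx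
      have ht' : t ∈ Icc 0 δ.length := ⟨ht.1.le, ht.2.le⟩
      refine (δ.le_hat hf hc hc0 ht').trans ?_
      rw [hhE δ t ht', Dart.hat, Dart.hat, Dart.slope, Dart.slope, heq _ δ.base_mem,
        heq _ δ.tip_mem]
  have hDd : ∀ x, 0 ≤ D x + d x := fun x => by
    by_cases hx : x ∈ M.V
    · rw [hdV x hx]
      exact hφ x hx
    · rw [hDF x (by rintro rfl; exact hx hP₀), hFV x hx, zero_add]
      exact hd0 x hx
  have hlin : LinEquiv Γ F (F + d) := ⟨h, hh, fun P => by simpa using hd P⟩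
  have hF'0 : ∀ x, x ≠ P₀ → 0 ≤ (F + d) x := fun x hx => by
    have := hDd x
    rwa [hDF x hx] at this
  have hF'P : (F + d) P₀ < 0 := by
    by_contra! hge
    refine hF ⟨F + d, fun x => ?_, hlin⟩
    by_cases hx : x = P₀
    · rwa [hx]
    · exact hF'0 x hx
  obtain ⟨M', hM'⟩ := hΓ.exists_model (insert P₀ (F + d).support ∪ S)
  have hP₀' : P₀ ∈ M'.V := hM' (by simp)
  obtain ⟨π, hπ, hle⟩ := M'.exists_le_orient (F := F + d) fun B hB hBne => by
    by_contra! hB'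
    have hP₀B : P₀ ∉ B := fun hmem => by
      have h1 : _ ≤ (F + d) P₀ := hB' P₀ hmem
      have : 0 ≤ M'.sumAt (fun δ => if δ.tip ∈ B then (0 : ℤ) else 1) P₀ :=
        sumAt_nonneg fun δ _ => by split_ifs <;> norm_num
      linarith
    obtain ⟨g, hg, hg0, hgB, hgV, c, hc, hc0, hcB⟩ := M'.exists_bump hΓ B hB
    obtain ⟨v, hv⟩ := hBne
    have := hmax' (h + g) (hh.add hg) (d + c) (fun P => (hd P).add (hc P)) (fun x => ?_)
      (by simp [hgV P₀ hP₀' hP₀B]) (fun x => by simpa using hg0 x) v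
    · have := hgB v hv
      simp only [Pi.add_apply] at *
      linarith
    · by_cases hx : x ∈ B
      · have h1 := hB' x hx
        have h2 := hcB x hx
        rw [hDF x (by rintro rfl; exact hP₀B hx)]
        simp only [Finsupp.coe_add, Pi.add_apply] at *
        linarith
      · have h1 := hDd x
        have h2 := hc0 x hx
        simp only [Pi.add_apply]
        linarith
  refine ⟨M', (Finset.subset_union_right).trans hM', π, hπ, F + d, hlin, fun x => ?_⟩
  rw [Finsupp.sub_apply, sub_nonneg]
  by_cases hx : x ∈ M'.V
  · exact hle x hx
  · rw [orient_apply_of_notMem π hx]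
    have : x ∉ (F + d).support := fun hs =>
      hx (hM' (Finset.mem_union_left _ (Finset.mem_insert_of_mem hs)))
    exact (Finsupp.notMem_support_iff.1 this).le

section Rank

variable {Γ : Type}

theorem Effective.exists_sub_of_le {E : Divisor Γ} (hE : Effective E) (a : ℕ)
    (ha : (a : ℤ) ≤ divDeg E) : ∃ E₁ : Divisor Γ, Effective E₁ ∧ Effective (E - E₁) ∧
      divDeg E₁ = a := by
  classical
  induction a with
  | zero => exact ⟨0, fun _ => le_rfl, by simpa using hE, by simp [divDeg]⟩
  | succ a ih =>
    obtain ⟨E₁, h₁, h₂, hdeg⟩ := ih (by push_cast at ha; linarith)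
    obtain ⟨P, hP⟩ : ∃ P, 0 < (E - E₁) P := by
      by_contra! h
      have : E - E₁ = 0 := Finsupp.ext fun P => le_antisymm (h P) (h₂ P)
      rw [sub_eq_zero.1 this, hdeg] at ha
      push_cast at ha
      linarith
    refine ⟨E₁ + Finsupp.single P 1, h₁.add (.single P zero_le_one), fun Q => ?_, ?_⟩
    · have := h₂ Q
      by_cases hQ : P = Q
      · subst hQ
        simp only [Finsupp.sub_apply, Finsupp.add_apply, Finsupp.single_eq_same] at *
        linarith
      · simpa [Finsupp.single_apply, hQ] using this
    · rw [divDeg_add, divDeg_single, hdeg]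
      push_cast
      rfl

variable [MetricSpace Γ]

theorem RankGE.equivEffective (hΓ : IsMetricGraph Γ) {D : Divisor Γ} {r : ℕ} (h : RankGE Γ D r)
    {G : Divisor Γ} (hG : Effective G) (hGr : divDeg G ≤ r) : EquivEffective Γ (D - G) := by
  have := hΓ.2.1
  obtain ⟨P₀⟩ : Nonempty Γ := inferInstance
  have hs : Effective (Finsupp.single P₀ (r - divDeg G)) := .single P₀ (sub_nonneg.2 hGr)
  obtain ⟨D', hD', hlin⟩ := h (G + Finsupp.single P₀ (r - divDeg G)) (hG.add hs)
    (by rw [divDeg_add, divDeg_single]; ring)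
  refine ⟨D' + Finsupp.single P₀ (r - divDeg G), hD'.add hs, ?_⟩
  convert hlin.add (LinEquiv.refl hΓ (Finsupp.single P₀ (r - divDeg G))) using 1
  abel

theorem RankGE.add {D F : Divisor Γ} {a b : ℕ} (hD : RankGE Γ D a) (hF : RankGE Γ F b) :
    RankGE Γ (D + F) (a + b) := by
  intro E hE hdeg
  obtain ⟨E₁, h₁, h₂, hdeg₁⟩ := hE.exists_sub_of_le a (by rw [hdeg]; push_cast; linarith)
  obtain ⟨D', hD', hlin⟩ := hD E₁ h₁ hdeg₁
  obtain ⟨F', hF', hlin'⟩ := hF (E - E₁) h₂ (by rw [divDeg_sub, hdeg, hdeg₁]; push_cast; ring)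
  refine ⟨D' + F', hD'.add hF', ?_⟩
  convert hlin.add hlin' using 1
  abel

theorem RankGE.le_divDeg (hΓ : IsMetricGraph Γ) {D : Divisor Γ} {r : ℕ} (h : RankGE Γ D r) :
    (r : ℤ) ≤ divDeg D := by
  have := hΓ.2.1
  obtain ⟨P₀⟩ : Nonempty Γ := inferInstance
  obtain ⟨D', hD', hlin⟩ := h (Finsupp.single P₀ r) (.single P₀ (Int.natCast_nonneg r))
    (divDeg_single _ _)
  have h₁ := hlin.divDeg_eq hΓ
  rw [divDeg_sub, divDeg_single] at h₁
  have := hD'.divDeg_nonneg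
  linarith

theorem exists_rankGE_of_divRank_pos (hΓ : IsMetricGraph Γ) {D : Divisor Γ}
    (h : 0 < divRank Γ D) : ∃ r : ℕ, divRank Γ D = r ∧ RankGE Γ D r ∧ ¬ RankGE Γ D (r + 1) := by
  have hbdd : BddAbove (insert (-1) {n : ℤ | ∃ r : ℕ, n = (r : ℤ) ∧ RankGE Γ D r}) := by
    refine ⟨max (-1) (divDeg D), ?_⟩
    rintro n (rfl | ⟨r, rfl, hr⟩)
    · exact le_max_left _ _
    · exact le_max_of_le_right (hr.le_divDeg hΓ)
  rcases Int.csSup_mem (insert_nonempty _ _) hbdd with hmem | ⟨r, hr, hD⟩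
  · rw [divRank, hmem] at h
    norm_num at h
  · refine ⟨r, hr, hD, fun hr' => ?_⟩
    have := (le_csSup hbdd (mem_insert_of_mem _ ⟨r + 1, rfl, hr'⟩)).trans_eq hr
    push_cast at this
    linarith

/-- One half of the Riemann–Roch theorem. -/
theorem RankGE.canonical_sub (hΓ : IsMetricGraph Γ) {K : Divisor Γ} (hK : IsCanonical Γ K)
    {D : Divisor Γ} {r s : ℕ} (hD : RankGE Γ D r)
    (hs : 2 * (s : ℤ) ≤ 2 * r - 2 * divDeg D + divDeg K) : RankGE Γ (K - D) s := by
  have := hΓ.2.1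
  intro E hE hdeg
  by_contra hF
  obtain ⟨M, hM, π, hπ, F', hlin, heff⟩ := exists_orient_sub_effective hΓ hF K.support
  have hor := GraphModel.orient_add_orient_neg hΓ hK hM hπ
  have hdegK : divDeg K = 2 * divDeg (M.orient π) := by
    rw [← hor, divDeg_add, GraphModel.divDeg_orient_neg, two_mul]
  have hdegF := hlin.divDeg_eq hΓ
  simp only [divDeg_sub] at hdegF
  obtain ⟨D₁, hD₁, hlin₁⟩ := hD.equivEffective hΓ heff (by rw [divDeg_sub]; linarith)
  refine M.not_equivEffective_orient (-π) ⟨D₁ + E, hD₁.add hE, ?_⟩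
  convert (hlin₁.add (LinEquiv.refl hΓ E)).add (hlin.sub (LinEquiv.refl hΓ F')) using 1
  · rw [eq_sub_of_add_eq' hor]
    abel
  · abel

theorem IsCanonical.even_divDeg (hΓ : IsMetricGraph Γ) {K : Divisor Γ} (hK : IsCanonical Γ K) :
    Even (divDeg K) := by
  have := hΓ.2.1
  obtain ⟨P₀⟩ : Nonempty Γ := inferInstance
  have hF : ¬ EquivEffective Γ (Finsupp.single P₀ (-1)) := by
    rintro ⟨D, hD, hlin⟩
    have := hlin.divDeg_eq hΓ
    rw [divDeg_single] at this
    have := hD.divDeg_nonneg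
    omega
  obtain ⟨M, hM, π, hπ, -⟩ := exists_orient_sub_effective hΓ hF K.support
  rw [← GraphModel.orient_add_orient_neg hΓ hK hM hπ, divDeg_add, GraphModel.divDeg_orient_neg]
  exact ⟨_, rfl⟩

end Rank

/-- Clifford inequality for metric graphs: a very special divisor `D`
on a metric graph `Γ` of genus `g` satisfies `deg(D) ≥ 2·rk(D)`. -/
theorem statement15 (Γ : Type) [MetricSpace Γ] (hΓ : IsMetricGraph Γ)
    (g : ℤ) (hg : graphGenus Γ = g)
    (D : Divisor Γ) (hD : VerySpecial Γ D) :
    2 * divRank Γ D ≤ divDeg D := by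
  obtain ⟨-, hD₀, K, hK, hKD⟩ := hD
  obtain ⟨r, hr, hDr, -⟩ := exists_rankGE_of_divRank_pos hΓ hD₀
  obtain ⟨b, -, hb, hb'⟩ := exists_rankGE_of_divRank_pos hΓ hKD
  obtain ⟨k, hk⟩ := hK.even_divDeg hΓ
  have hsum : RankGE Γ K (r + b) := by simpa using hDr.add hb
  have h₁ : (r : ℤ) + b ≤ k := by
    by_contra! hlt
    have := (hsum.canonical_sub hΓ hK (s := 1) (by push_cast; omega)).le_divDeg hΓ
    rw [divDeg_sub] at this
    norm_num at this
  have h₂ : (r : ℤ) - divDeg D + k ≤ b := by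
    by_contra! hlt
    exact hb' (hDr.canonical_sub hΓ hK (by push_cast; omega))
  rw [hr]
  linarith
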